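/- Let B be a separable C*-algebra such that every *-homomorphism from B to ∏_n M_n / ⊕_{2,ω} M_n that has a cp lift to ∏_n M_n lifts (respectively, asymptotically lifts) to a cp discrete asymptotic homomorphism from B to ∏_n M_n. Then: (1) every amenable trace on B is quasidiagonal; (2) if a separable C*-algebra A is homotopy dominated by B, then every *-homomorphism from A to ∏_n M_n / ⊕_{2,ω} M_n that has a cp lift to ∏_n M_n lifts (respectively, asymptotically lifts) to a cp discrete asymptotic homomorphism from A to ∏_n M_n; in particular, every amenable trace on A is quasidiagonal. -/

import Mathlib

set_option synthInstance.maxHeartbeats 1000000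
set_option maxHeartbeats 2000000

open Filter Topology
open scoped ENNReal ComplexOrder

noncomputable section

/-- The matrix algebra `M_n`, realized as operators on the `n`-dimensional Hilbert space. -/
abbrev MatAlg (n : ℕ) := EuclideanSpace ℂ (Fin n) →L[ℂ] EuclideanSpace ℂ (Fin n)

/-- The normalized trace `tr_n` on `M_n`. -/
def matTrace (n : ℕ) (T : MatAlg n) : ℂ :=
  (LinearMap.trace ℂ (EuclideanSpace ℂ (Fin n)))
    (T : EuclideanSpace ℂ (Fin n) →ₗ[ℂ] EuclideanSpace ℂ (Fin n)) / n

/-- The normalized 2-norm `‖x‖₂ = tr_n(x*x)^{1/2}` on `M_n`. -/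
def l2Norm (n : ℕ) (T : MatAlg n) : ℝ :=
  Real.sqrt (matTrace n (star T * T)).re

/-- A trace (tracial positive contractive linear functional) on a C*-algebra. -/
def IsTrace {A : Type*} [NonUnitalCStarAlgebra A] (τ : A → ℂ) : Prop :=
  (∀ a b, τ (a + b) = τ a + τ b) ∧ (∀ (c : ℂ) (a : A), τ (c • a) = c * τ a) ∧
  (∀ a, 0 ≤ τ (star a * a)) ∧ (∀ a b, τ (a * b) = τ (b * a)) ∧ (∀ a, ‖τ a‖ ≤ ‖a‖)

/-- A map between C*-algebras is completely positive. -/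
def IsCompletelyPositive {A B : Type*} [NonUnitalCStarAlgebra A] [NonUnitalCStarAlgebra B]
    (φ : A → B) : Prop :=
  (∀ a b, φ (a + b) = φ a + φ b) ∧ (∀ (c : ℂ) (a : A), φ (c • a) = c • φ a) ∧
  ∀ (k : ℕ) (x : Matrix (Fin k) (Fin k) A),
    (∃ y : Matrix (Fin k) (Fin k) A, x = star y * y) →
    ∃ z : Matrix (Fin k) (Fin k) B, x.map φ = star z * z

/-- A contractive completely positive (ccp) map. -/
def IsCCP {A B : Type*} [NonUnitalCStarAlgebra A] [NonUnitalCStarAlgebra B] (φ : A → B) : Prop :=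
  IsCompletelyPositive φ ∧ ∀ a, ‖φ a‖ ≤ ‖a‖

/-- An amenable trace: approximated by normalized matrix traces along ccp maps which are
approximately multiplicative in `‖·‖₂`. -/
def IsAmenableTrace {A : Type*} [NonUnitalCStarAlgebra A] (τ : A → ℂ) : Prop :=
  ∀ (G : Finset A) (ε : ℝ), 0 < ε → ∃ (n : ℕ) (φ : A → MatAlg n), IsCCP φ ∧
    (∀ a ∈ G, ∀ b ∈ G, l2Norm n (φ (a * b) - φ a * φ b) < ε) ∧
    (∀ a ∈ G, ‖τ a - matTrace n (φ a)‖ < ε)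

/-- A quasidiagonal trace: as amenable, but approximately multiplicative in operator norm. -/
def IsQuasidiagonalTrace {A : Type*} [NonUnitalCStarAlgebra A] (τ : A → ℂ) : Prop :=
  ∀ (G : Finset A) (ε : ℝ), 0 < ε → ∃ (n : ℕ) (φ : A → MatAlg n), IsCCP φ ∧
    (∀ a ∈ G, ∀ b ∈ G, ‖φ (a * b) - φ a * φ b‖ < ε) ∧
    (∀ a ∈ G, ‖τ a - matTrace n (φ a)‖ < ε)

/-- A discrete asymptotic homomorphism between C*-algebras, indexed by `ℕ`. -/
def IsDiscreteAsymptoticHom {A B : Type*} [NonUnitalCStarAlgebra A] [NonUnitalCStarAlgebra B]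
    (f : ℕ → A → B) : Prop :=
  (∀ a b : A, Tendsto (fun n => ‖f n (a * b) - f n a * f n b‖) atTop (𝓝 0)) ∧
  (∀ (μ₁ μ₂ : ℂ) (a b : A),
    Tendsto (fun n => ‖f n (μ₁ • a + μ₂ • b) - (μ₁ • f n a + μ₂ • f n b)‖) atTop (𝓝 0)) ∧
  (∀ a : A, Tendsto (fun n => ‖f n (star a) - star (f n a)‖) atTop (𝓝 0)) ∧
  (∀ a : A, ∃ C : ℝ, ∀ n, ‖f n a‖ ≤ C)

-- shortcut instances, to speed up elaboration
instance : NonUnitalCStarAlgebra (lp (fun n => MatAlg n) ∞) := inferInstance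
instance : Star (lp (fun n => MatAlg n) ∞) := inferInstance
instance : Sub (lp (fun n => MatAlg n) ∞) := inferInstance
instance : Mul (lp (fun n => MatAlg n) ∞) := inferInstance
instance : Add (lp (fun n => MatAlg n) ∞) := inferInstance
instance : SMul ℂ (lp (fun n => MatAlg n) ∞) := inferInstance
instance : Norm (lp (fun n => MatAlg n) ∞) := inferInstance

/-- Membership in the ideal `⊕_{2,ω} M_n ⊆ ∏ₙ M_n` of sequences tending to `0` in the
normalized 2-norm along the free ultrafilter `ω`. -/
def twoOmegaMem (ω : Ultrafilter ℕ) (x : lp (fun n => MatAlg n) ∞) : Prop :=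
  Tendsto (fun n => (matTrace n (star (x n) * x n)).re) (ω : Filter ℕ) (𝓝 0)

/-- The quotient norm on `∏ₙ M_n / ⊕_{2,ω} M_n`, evaluated on a representative. -/
def quotNorm (ω : Ultrafilter ℕ) (x : lp (fun n => MatAlg n) ∞) : ℝ :=
  sInf {r : ℝ | ∃ j, twoOmegaMem ω j ∧ r = ‖x + j‖}

/-- A function into `∏ₙ M_n` represents a ∗-homomorphism into `∏ₙ M_n / ⊕_{2,ω} M_n`. -/
def IsHomModJ {A : Type*} [NonUnitalCStarAlgebra A] (ω : Ultrafilter ℕ)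
    (f : A → lp (fun n => MatAlg n) ∞) : Prop :=
  (∀ a b, twoOmegaMem ω (f (a * b) - f a * f b)) ∧
  (∀ a b, twoOmegaMem ω (f (a + b) - (f a + f b))) ∧
  (∀ (c : ℂ) (a : A), twoOmegaMem ω (f (c • a) - c • f a)) ∧
  (∀ a, twoOmegaMem ω (f (star a) - star (f a)))

/-- `f` (a representative of a ∗-homomorphism into the quotient) has a completely positive
lift to `∏ₙ M_n`. -/
def HasCpLift {A : Type*} [NonUnitalCStarAlgebra A] (ω : Ultrafilter ℕ)
    (f : A → lp (fun n => MatAlg n) ∞) : Prop :=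
  ∃ F : A → lp (fun n => MatAlg n) ∞, IsCompletelyPositive F ∧ ∀ a, twoOmegaMem ω (f a - F a)

/-- Every ∗-homomorphism from `A` to `∏ₙ M_n / ⊕_{2,ω} M_n` having a cp lift lifts to a cp
discrete asymptotic homomorphism into `∏ₙ M_n`. -/
def AllCpLiftableHomsLiftCp (A : Type*) [NonUnitalCStarAlgebra A] (ω : Ultrafilter ℕ) : Prop :=
  ∀ f : A → lp (fun n => MatAlg n) ∞, IsHomModJ ω f → HasCpLift ω f →
    ∃ Φ : ℕ → A → lp (fun n => MatAlg n) ∞, IsDiscreteAsymptoticHom Φ ∧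
      (∀ k, IsCompletelyPositive (Φ k)) ∧ ∀ k a, twoOmegaMem ω (f a - Φ k a)

/-- Every ∗-homomorphism from `A` to `∏ₙ M_n / ⊕_{2,ω} M_n` having a cp lift asymptotically
lifts to a cp discrete asymptotic homomorphism into `∏ₙ M_n`. -/
def AllCpLiftableHomsLiftCpAsymptotically (A : Type*) [NonUnitalCStarAlgebra A]
    (ω : Ultrafilter ℕ) : Prop :=
  ∀ f : A → lp (fun n => MatAlg n) ∞, IsHomModJ ω f → HasCpLift ω f →
    ∃ Φ : ℕ → A → lp (fun n => MatAlg n) ∞, IsDiscreteAsymptoticHom Φ ∧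
      (∀ k, IsCompletelyPositive (Φ k)) ∧
      ∀ a, Tendsto (fun k => quotNorm ω (Φ k a - f a)) atTop (𝓝 0)

/-- Two ∗-homomorphisms `φ, ψ : B → A` are homotopic. -/
def AreHomotopic {B A : Type*} [NonUnitalCStarAlgebra A] [NonUnitalCStarAlgebra B]
    (φ ψ : B →⋆ₙₐ[ℂ] A) : Prop :=
  ∃ Φ : B →⋆ₙₐ[ℂ] C(unitInterval, A), (∀ b, Φ b 0 = ψ b) ∧ (∀ b, Φ b 1 = φ b)

/-- If `p, q` are commuting self-adjoint elements with `p² + q² = 1`, then compressing a block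
diagonal element by the isometry `(p, q)` does not increase the norm. -/
theorem norm_compression_le {P : Type*} [CStarAlgebra P] {p q : P}
    (hp : star p = p) (hq : star q = q) (hpq : p * q = q * p) (h1 : p * p + q * q = 1)
    (E R : P) {m : ℝ} (hE : ‖E‖ ≤ m) (hR : ‖R‖ ≤ m) :
    ‖p * E * p + q * R * q‖ ≤ m := by
  let _ := CStarAlgebra.spectralOrder P
  have := CStarAlgebra.spectralOrderedRing P
  have hm : 0 ≤ m := (norm_nonneg _).trans hE
  set T := p * E * p + q * R * q with hT
  have hsT : star T = p * star E * p + q * star R * q := by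
    simp [hT, star_mul, hp, hq, mul_assoc]
  set S := q * E * p - p * R * q with hS
  have hsS : star S = p * star E * q - q * star R * p := by
    simp [hS, star_mul, hp, hq, mul_assoc]
  have hid : star T * T = p * (star E * E) * p + q * (star R * R) * q - star S * S := by
    have e1 : p * p = 1 - q * q := eq_sub_of_add_eq h1
    have : star T * T + star S * S = p * star E * (p * p + q * q) * E * p
        + q * star R * (p * p + q * q) * R * q
        + p * star E * (p * q - q * p) * R * q + q * star R * (q * p - p * q) * E * p := by
      rw [hsT, hsS, hT, hS]; noncomm_ring
    rw [eq_sub_iff_add_eq, this, h1, hpq]; noncomm_ring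
  have key : ∀ x : P, ‖x‖ ≤ m → ∀ c : P, star c = c →
      c * (star x * x) * c ≤ (m ^ 2) • (c * c) := by
    intro x hx c hc
    have h := CStarAlgebra.star_left_conjugate_le_norm_smul (a := c) (b := star x * x)
      (hb := IsSelfAdjoint.star_mul_self x)
    rw [hc, CStarRing.norm_star_mul_self] at h
    refine h.trans (smul_le_smul_of_nonneg_right (by nlinarith [norm_nonneg x]) ?_)
    simpa [hc] using star_mul_self_nonneg c
  have hle : star T * T ≤ algebraMap ℝ P (m ^ 2) := by
    calc star T * T ≤ p * (star E * E) * p + q * (star R * R) * q := by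
          rw [hid]; exact sub_le_self _ (star_mul_self_nonneg S)
      _ ≤ (m ^ 2) • (p * p) + (m ^ 2) • (q * q) := add_le_add (key E hE p hp) (key R hR q hq)
      _ = algebraMap ℝ P (m ^ 2) := by rw [← smul_add, h1, Algebra.algebraMap_eq_smul_one]
  have h2 := (CStarAlgebra.norm_le_iff_le_algebraMap _ (sq_nonneg m)
    (star_mul_self_nonneg T)).2 hle
  rw [CStarRing.norm_star_mul_self] at h2
  nlinarith [norm_nonneg T]

/-- A two-sided ideal contains approximate units for its finite subsets. -/
theorem exists_approx_unit {P : Type*} [CStarAlgebra P] (J : TwoSidedIdeal P)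
    (K : Finset P) (hK : ∀ x ∈ K, x ∈ J) {ε : ℝ} (hε : 0 < ε) :
    ∃ u ∈ J, star u = u ∧ ‖u‖ ≤ 1 ∧ ∀ x ∈ K, ‖(1 - u) * x‖ ≤ ε := by
  let _ := CStarAlgebra.spectralOrder P
  have := CStarAlgebra.spectralOrderedRing P
  set h : P := ∑ x ∈ K, x * star x with hh
  have hh0 : 0 ≤ h := Finset.sum_nonneg fun x _ => mul_star_self_nonneg x
  have hhJ : h ∈ J := sum_mem fun x hx => J.mul_mem_right _ _ (hK x hx)
  have hsa : IsSelfAdjoint h := .of_nonneg hh0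
  set γ := ε ^ 2 with hγ
  have hγ0 : 0 < γ := by positivity
  have hsp : ∀ t ∈ spectrum ℝ h, 0 ≤ t := fun t ht => spectrum_nonneg_of_nonneg hh0 ht
  have hne : ∀ t ∈ spectrum ℝ h, t + γ ≠ 0 := fun t ht => by linarith [hsp t ht]
  have hc : ContinuousOn (fun t : ℝ => t / (t + γ)) (spectrum ℝ h) :=
    continuousOn_id.div (by fun_prop) hne
  have hci : ContinuousOn (fun t : ℝ => (t + γ)⁻¹) (spectrum ℝ h) :=
    ContinuousOn.inv₀ (by fun_prop) hne
  refine ⟨cfc (fun t : ℝ => t / (t + γ)) h, ?_, ?_, ?_, ?_⟩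
  · have : cfc (fun t : ℝ => t / (t + γ)) h = h * cfc (fun t : ℝ => (t + γ)⁻¹) h := by
      conv_rhs => lhs; rw [← cfc_id' ℝ h hsa]
      rw [← cfc_mul (fun t : ℝ => t) _ h continuousOn_id hci]
      exact cfc_congr fun t _ => div_eq_mul_inv _ _
    rw [this]; exact J.mul_mem_right _ _ hhJ
  · exact (cfc_predicate (R := ℝ) _ h : IsSelfAdjoint _)
  · refine norm_cfc_le zero_le_one fun t ht => ?_
    have := hsp t ht
    rw [Real.norm_of_nonneg (by positivity), div_le_one (by positivity)]; linarith
  · intro x hx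
    set v := 1 - cfc (fun t : ℝ => t / (t + γ)) h with hv
    have hv' : v = cfc (fun t : ℝ => γ / (t + γ)) h := by
      rw [hv, ← cfc_one ℝ h, ← cfc_sub _ _ h (by fun_prop) hc]
      refine cfc_congr fun t ht => ?_
      have := hne t ht
      simp only [Pi.one_apply]
      field_simp; ring
    have hsv : star v = v := by
      rw [hv']; exact (cfc_predicate (R := ℝ) _ h : IsSelfAdjoint _)
    have hcv : ContinuousOn (fun t : ℝ => γ / (t + γ)) (spectrum ℝ h) :=
      continuousOn_const.div (by fun_prop) hne
    have hxh : x * star x ≤ h :=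
      Finset.single_le_sum (f := fun x => x * star x) (fun x _ => mul_star_self_nonneg x) hx
    have hle : (v * x) * star (v * x) ≤ v * h * v := by
      have := star_left_conjugate_le_conjugate hxh v
      rw [hsv] at this
      simpa [star_mul, hsv, mul_assoc] using this
    have hn : ‖v * h * v‖ ≤ γ := by
      have : v * h * v = cfc (fun t : ℝ => γ / (t + γ) * t * (γ / (t + γ))) h := by
        rw [cfc_mul (fun t : ℝ => γ / (t + γ) * t) _ h (hcv.mul continuousOn_id) hcv,
          cfc_mul _ (fun t : ℝ => t) h hcv continuousOn_id, ← hv', cfc_id' ℝ h]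
      rw [this]
      refine norm_cfc_le hγ0.le fun t ht => ?_
      have ht0 := hsp t ht
      rw [Real.norm_of_nonneg (by positivity)]
      have e : γ / (t + γ) * t * (γ / (t + γ)) = γ * ((γ * t) / (t + γ) ^ 2) := by
        field_simp
      rw [e]
      have : (γ * t) / (t + γ) ^ 2 ≤ 1 := by
        rw [div_le_one (by positivity)]; nlinarith
      nlinarith
    have := (CStarAlgebra.norm_le_norm_of_nonneg_of_le (mul_star_self_nonneg _) hle).trans hn
    rw [CStarRing.norm_self_mul_star, hγ] at this
    nlinarith [norm_nonneg (v * x)]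

/-- Two-sided version of `exists_approx_unit`. -/
theorem exists_approx_unit_two_sided {P : Type*} [CStarAlgebra P] (J : TwoSidedIdeal P)
    (hJ : ∀ x ∈ J, star x ∈ J) (K : Finset P) (hK : ∀ x ∈ K, x ∈ J) {ε : ℝ} (hε : 0 < ε) :
    ∃ u ∈ J, star u = u ∧ ‖u‖ ≤ 1 ∧ ∀ x ∈ K, ‖(1 - u) * x‖ ≤ ε ∧ ‖x * (1 - u)‖ ≤ ε := by
  classical
  obtain ⟨u, huJ, hu, hu1, h⟩ := exists_approx_unit J (K ∪ K.image star)
    (by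
      intro x hx
      rcases Finset.mem_union.1 hx with hx | hx
      · exact hK x hx
      · obtain ⟨y, hy, rfl⟩ := Finset.mem_image.1 hx
        exact hJ y (hK y hy)) hε
  refine ⟨u, huJ, hu, hu1, fun x hx => ⟨h x (Finset.mem_union_left _ hx), ?_⟩⟩
  have := h (star x) (Finset.mem_union_right _ (Finset.mem_image_of_mem _ hx))
  rwa [← norm_star, star_mul, star_star, star_sub, star_one, hu] at this

/-- Two-sided ideals contain quasicentral approximate units, version for self-adjoint elements. -/
theorem exists_quasicentral_of_selfAdjoint {P : Type*} [CStarAlgebra P] (J : TwoSidedIdeal P)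
    (hJ : ∀ x ∈ J, star x ∈ J) (K : Finset P) (hK : ∀ x ∈ K, x ∈ J)
    (X : Finset P) (hX : ∀ x ∈ X, star x = x) {ε : ℝ} (hε : 0 < ε) :
    ∃ w ∈ J, star w = w ∧ ‖w‖ ≤ 1 ∧ (∀ x ∈ K, ‖(1 - w) * x‖ ≤ ε ∧ ‖x * (1 - w)‖ ≤ ε) ∧
      ∀ x ∈ X, ‖w * x - x * w‖ ≤ ε := by
  classical
  obtain ⟨M, hM0, hM⟩ : ∃ M : ℝ, 0 ≤ M ∧ ∀ x ∈ X, ‖x‖ ≤ M :=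
    ⟨∑ x ∈ X, ‖x‖, Finset.sum_nonneg fun _ _ => norm_nonneg _, fun x hx =>
      Finset.single_le_sum (f := fun x : P => ‖x‖) (fun _ _ => norm_nonneg _) hx⟩
  obtain ⟨N, hN⟩ := exists_nat_gt ((4 * M ^ 2 + 1) / ε ^ 2)
  have hN0 : (0 : ℝ) < N := lt_of_le_of_lt (by positivity) hN
  set γ : ℝ := 1 / (N * (1 + M)) with hγ
  have hγ0 : 0 < γ := by positivity
  obtain ⟨u, hu, hur⟩ := exists_seq_of_forall_finset_exists
    (fun u : P => u ∈ J ∧ star u = u ∧ ‖u‖ ≤ 1 ∧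
      ∀ x ∈ K, ‖(1 - u) * x‖ ≤ ε ∧ ‖x * (1 - u)‖ ≤ ε)
    (fun u v : P => ∀ x ∈ X, ‖(1 - v) * (u * x - x * u)‖ ≤ γ ∧
      ‖(1 - v) * (x * (u * x - x * u))‖ ≤ γ)
    (by
      intro s hs
      have hcJ : ∀ u ∈ s, ∀ x, u * x - x * u ∈ J := fun u hu x =>
        J.sub_mem (J.mul_mem_right _ _ (hs u hu).1) (J.mul_mem_left _ _ (hs u hu).1)
      obtain ⟨v, hvJ, hv, hv1, h⟩ := exists_approx_unit_two_sided J hJ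
        (K ∪ ((s ×ˢ X).image (fun z => z.1 * z.2 - z.2 * z.1) ∪
          (s ×ˢ X).image (fun z => z.2 * (z.1 * z.2 - z.2 * z.1))))
        (by
          intro y hy
          simp only [Finset.mem_union, Finset.mem_image, Finset.mem_product] at hy
          rcases hy with hy | ⟨z, hz, rfl⟩ | ⟨z, hz, rfl⟩
          · exact hK y hy
          · exact hcJ _ hz.1 _
          · exact J.mul_mem_left _ _ (hcJ _ hz.1 _)) (lt_min hε hγ0)
      refine ⟨v, ⟨hvJ, hv, hv1, fun x hx => ?_⟩, fun u hu x hx => ⟨?_, ?_⟩⟩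
      · obtain ⟨h1, h2⟩ := h x (Finset.mem_union_left _ hx)
        exact ⟨h1.trans (min_le_left _ _), h2.trans (min_le_left _ _)⟩
      · refine ((h _ ?_).1).trans (min_le_right _ _)
        exact Finset.mem_union_right _ (Finset.mem_union_left _
          (Finset.mem_image.2 ⟨(u, x), Finset.mem_product.2 ⟨hu, hx⟩, rfl⟩))
      · refine ((h _ ?_).1).trans (min_le_right _ _)
        exact Finset.mem_union_right _ (Finset.mem_union_right _
          (Finset.mem_image.2 ⟨(u, x), Finset.mem_product.2 ⟨hu, hx⟩, rfl⟩)))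
  have avg_norm : ∀ (y : ℕ → P) (C : ℝ), (∀ k, ‖y k‖ ≤ C) →
      ‖((N : ℝ)⁻¹) • ∑ k ∈ Finset.range N, y k‖ ≤ C := by
    intro y C hy
    rw [norm_smul, Real.norm_of_nonneg (by positivity)]
    have := norm_sum_le_of_le (Finset.range N) (f := y) (n := fun _ => C) fun k _ => hy k
    rw [Finset.sum_const, Finset.card_range, nsmul_eq_mul] at this
    rw [inv_mul_le_iff₀ hN0]; exact this
  have avg_one : ∀ a : P, ((N : ℝ)⁻¹) • ∑ k ∈ Finset.range N, a = a := by
    intro a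
    rw [Finset.sum_const, Finset.card_range, ← Nat.cast_smul_eq_nsmul ℝ, smul_smul,
      inv_mul_cancel₀ hN0.ne', one_smul]
  set w : P := ((N : ℝ)⁻¹) • ∑ k ∈ Finset.range N, u k with hw
  have hwJ : w ∈ J := by
    have : w = (algebraMap ℝ P (N : ℝ)⁻¹) * ∑ k ∈ Finset.range N, u k := by
      rw [hw, Algebra.smul_def]
    rw [this]
    exact J.mul_mem_left _ _ (sum_mem fun k _ => (hu k).1)
  refine ⟨w, hwJ, ?_, avg_norm u 1 fun k => (hu k).2.2.1, fun x hx => ⟨?_, ?_⟩, fun x hx => ?_⟩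
  · simp only [hw, star_smul, star_sum, star_trivial]
    congr 1
    exact Finset.sum_congr rfl fun k _ => (hu k).2.1
  · have : (1 - w) * x = ((N : ℝ)⁻¹) • ∑ k ∈ Finset.range N, (1 - u k) * x := by
      rw [← Finset.sum_mul, Finset.sum_sub_distrib, ← smul_mul_assoc, smul_sub, avg_one]
    rw [this]
    exact avg_norm _ _ fun k => ((hu k).2.2.2 x hx).1
  · have : x * (1 - w) = ((N : ℝ)⁻¹) • ∑ k ∈ Finset.range N, x * (1 - u k) := by
      rw [← Finset.mul_sum, Finset.sum_sub_distrib, ← mul_smul_comm, smul_sub, avg_one]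
    rw [this]
    exact avg_norm _ _ fun k => ((hu k).2.2.2 x hx).2
  · set c : ℕ → P := fun k => u k * x - x * u k with hc
    have hwc : w * x - x * w = ((N : ℝ)⁻¹) • ∑ k ∈ Finset.range N, c k := by
      simp only [hw, hc, Finset.sum_sub_distrib, smul_sub, ← Finset.sum_mul, ← Finset.mul_sum,
        smul_mul_assoc, mul_smul_comm]
    have hcs : ∀ k, star (c k) = - c k := by
      intro k
      simp only [hc, star_sub, star_mul, (hu k).2.1, hX x hx]; abel
    have hcn : ∀ k, ‖c k‖ ≤ 2 * M := by
      intro k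
      calc ‖c k‖ ≤ ‖u k * x‖ + ‖x * u k‖ := norm_sub_le _ _
        _ ≤ ‖u k‖ * ‖x‖ + ‖x‖ * ‖u k‖ := add_le_add (norm_mul_le _ _) (norm_mul_le _ _)
        _ ≤ 2 * M := by nlinarith [hM x hx, (hu k).2.2.1, norm_nonneg x, norm_nonneg (u k)]
    have hlt : ∀ l k, l < k → ‖c k * c l‖ ≤ 1 / N := by
      intro l k hlk
      obtain ⟨h1, h2⟩ := hur l k hlk x hx
      have e : c k * c l = x * ((1 - u k) * c l) - (1 - u k) * (x * c l) := by
        simp only [hc]; noncomm_ring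
      rw [e]
      calc _ ≤ ‖x * ((1 - u k) * c l)‖ + ‖(1 - u k) * (x * c l)‖ := norm_sub_le _ _
        _ ≤ M * γ + γ := add_le_add ((norm_mul_le _ _).trans
            (mul_le_mul (hM x hx) h1 (norm_nonneg _) hM0)) h2
        _ = 1 / N := by rw [hγ]; field_simp; ring
    have hne : ∀ l k, l ≠ k → ‖c k * c l‖ ≤ 1 / N := by
      intro l k hlk
      rcases lt_or_gt_of_ne hlk with h | h
      · exact hlt l k h
      · have := hlt k l h
        rwa [← norm_star, star_mul, hcs, hcs, neg_mul_neg] at this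
    set S := ∑ k ∈ Finset.range N, c k with hS
    have hSS : ‖S‖ * ‖S‖ ≤ N * (4 * M ^ 2 + 1) := by
      have hsS : star S = - S := by
        simp only [hS, star_sum, hcs, Finset.sum_neg_distrib]
      rw [← CStarRing.norm_star_mul_self, hsS, neg_mul, norm_neg, hS, Finset.sum_mul_sum]
      have inner : ∀ k ∈ Finset.range N, ‖∑ l ∈ Finset.range N, c k * c l‖ ≤ 4 * M ^ 2 + 1 := by
        intro k hk
        rw [← Finset.add_sum_erase _ _ hk]
        refine (norm_add_le _ _).trans (add_le_add ?_ ?_)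
        · refine (norm_mul_le _ _).trans ?_
          nlinarith [hcn k, norm_nonneg (c k)]
        · refine (norm_sum_le_of_le _ (n := fun _ => 1 / (N : ℝ)) fun l hl =>
            hne l k (Finset.ne_of_mem_erase hl)).trans ?_
          rw [Finset.sum_const, nsmul_eq_mul, mul_one_div, div_le_one hN0]
          exact_mod_cast (Finset.card_le_card (Finset.erase_subset _ _)).trans_eq
            (Finset.card_range N)
      refine (norm_sum_le_of_le _ inner).trans ?_
      rw [Finset.sum_const, Finset.card_range, nsmul_eq_mul]
    rw [hwc, norm_smul, Real.norm_of_nonneg (by positivity), inv_mul_le_iff₀ hN0]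
    rw [div_lt_iff₀ (by positivity)] at hN
    refine abs_le_of_sq_le_sq' ?_ (by positivity) |>.2
    nlinarith

/-- Two-sided ideals contain quasicentral approximate units. -/
theorem exists_quasicentral {P : Type*} [CStarAlgebra P] (J : TwoSidedIdeal P)
    (hJ : ∀ x ∈ J, star x ∈ J) (K : Finset P) (hK : ∀ x ∈ K, x ∈ J)
    (X : Finset P) {ε : ℝ} (hε : 0 < ε) :
    ∃ w ∈ J, star w = w ∧ ‖w‖ ≤ 1 ∧ (∀ x ∈ K, ‖(1 - w) * x‖ ≤ ε ∧ ‖x * (1 - w)‖ ≤ ε) ∧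
      ∀ x ∈ X, ‖w * x - x * w‖ ≤ ε := by
  classical
  obtain ⟨w, hwJ, hw, hw1, hwK, hwX⟩ := exists_quasicentral_of_selfAdjoint J hJ K hK
    (X.image (fun x => x + star x) ∪ X.image (fun x => Complex.I • (x - star x)))
    (by
      intro x hx
      rcases Finset.mem_union.1 hx with hx | hx <;>
        obtain ⟨y, _, rfl⟩ := Finset.mem_image.1 hx
      · simp [add_comm]
      · simp [star_smul, ← smul_neg]) hε
  refine ⟨w, hwJ, hw, hw1, hwK, fun x hx => ?_⟩
  have h1 := hwX _ (Finset.mem_union_left _ (Finset.mem_image_of_mem _ hx))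
  have h2 := hwX _ (Finset.mem_union_right _ (Finset.mem_image_of_mem _ hx))
  simp only [mul_smul_comm, smul_mul_assoc, ← smul_sub, norm_smul, Complex.norm_I, one_mul] at h2
  have e : (2 : ℝ) • (w * x - x * w) = (w * (x + star x) - (x + star x) * w) +
      (w * (x - star x) - (x - star x) * w) := by
    rw [two_smul]; noncomm_ring
  have h3 := norm_add_le (w * (x + star x) - (x + star x) * w)
      (w * (x - star x) - (x - star x) * w)
  rw [← e, norm_smul] at h3
  norm_num at h3
  linarith

/-- A quasicentral partition of unity `p² + q² = 1` subordinate to a two-sided ideal. -/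
theorem exists_quasicentral_partition {P : Type*} [CStarAlgebra P] (J : TwoSidedIdeal P)
    (hJ : ∀ x ∈ J, star x ∈ J) (K : Finset P) (hK : ∀ x ∈ K, x ∈ J)
    (X : Finset P) {ε : ℝ} (hε : 0 < ε) :
    ∃ p q : P, p ∈ J ∧ 1 - q ∈ J ∧ star p = p ∧ star q = q ∧ p * q = q * p ∧
      p * p + q * q = 1 ∧ ‖p‖ ≤ 1 ∧ ‖q‖ ≤ 1 ∧ (∀ x ∈ K, ‖q * x‖ ≤ ε ∧ ‖x * q‖ ≤ ε) ∧
      ∀ x ∈ X, ‖p * x - x * p‖ ≤ ε ∧ ‖q * x - x * q‖ ≤ ε := by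
  obtain ⟨w, hwJ, hw, hw1, hwK, hwX⟩ := exists_quasicentral J hJ K hK X (ε := ε / 6)
    (by positivity)
  have hsa : IsSelfAdjoint w := hw
  have hne : ∀ t : ℝ, 1 + t ^ 2 ≠ 0 := fun t => by positivity
  have hcr : Continuous (fun t : ℝ => (1 + t ^ 2)⁻¹) := Continuous.inv₀ (by fun_prop) hne
  set r := cfc (fun t : ℝ => (1 + t ^ 2)⁻¹) w with hr
  have hrs : star r = r := (cfc_predicate (R := ℝ) _ w : IsSelfAdjoint _)
  have hr1 : ‖r‖ ≤ 1 := norm_cfc_le zero_le_one fun t _ => by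
    rw [Real.norm_of_nonneg (by positivity)]
    exact inv_le_one_of_one_le₀ (by nlinarith [sq_nonneg t])
  have hrw : r * w = w * r := by
    have h := (cfc_commute_cfc (fun t : ℝ => (1 + t ^ 2)⁻¹) (fun t : ℝ => t) w).eq
    rwa [cfc_id' ℝ w hsa] at h
  have hinv : (1 + w * w) * r = 1 := by
    have : 1 + w * w = cfc (fun t : ℝ => 1 + t ^ 2) w := by
      rw [cfc_const_add (1 : ℝ) (fun t : ℝ => t ^ 2) w (by fun_prop) hsa, cfc_pow_id w 2 hsa,
        pow_two, map_one]
    rw [this, hr, ← cfc_mul _ _ w (by fun_prop) hcr.continuousOn, ← cfc_one ℝ w]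
    exact cfc_congr fun t _ => mul_inv_cancel₀ (hne t)
  have hinv' : r * (1 + w * w) = 1 := by
    have hc : Commute r w := hrw
    rw [((Commute.one_right r).add_right (hc.mul_right hc)).eq, hinv]
  have hrww : r * (w * w) = 1 - r := by
    rw [eq_sub_iff_add_eq, add_comm]
    rwa [mul_add, mul_one] at hinv'
  set p := r * w + r * w with hp
  set q := r + r - 1 with hq
  have hq' : q = r * (1 + w) * (1 - w) := by
    have : r * (1 + w) * (1 - w) = r - r * (w * w) := by noncomm_ring
    rw [this, hrww, hq]; abel
  have hps : star p = p := by simp only [hp, star_add, star_mul, hrs, hw, hrw]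
  have hqs : star q = q := by simp only [hq, star_add, star_sub, star_one, hrs]
  have hpq : p * q = q * p := by
    have : r * w * r = r * (r * w) := by rw [mul_assoc, hrw]
    simp only [hp, hq, mul_add, add_mul, mul_sub, sub_mul, this, mul_one, one_mul]
    abel
  have hsum : p * p + q * q = 1 := by
    have e : r * w * (r * w) = r - r * r := by
      rw [mul_assoc, ← mul_assoc w, ← hrw, mul_assoc r w w, hrww, mul_sub, mul_one]
    have : p * p + q * q = 4 • (r * w * (r * w)) + 4 • (r * r) - 4 • r + 1 := by
      simp only [hp, hq]; noncomm_ring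
    rw [this, e, smul_sub]; abel
  have hnorm : ∀ a b : P, star a = a → star b = b → a * a + b * b = 1 → ‖a‖ ≤ 1 := by
    intro a b ha hb hab
    let _ := CStarAlgebra.spectralOrder P
    have := CStarAlgebra.spectralOrderedRing P
    have h1 : star a * a ≤ algebraMap ℝ P 1 := by
      rw [ha, map_one, ← hab]
      have := star_mul_self_nonneg b
      rw [hb] at this
      exact le_add_of_nonneg_right this
    have h2 := (CStarAlgebra.norm_le_iff_le_algebraMap _ zero_le_one (star_mul_self_nonneg a)).2 h1
    rw [CStarRing.norm_star_mul_self] at h2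
    nlinarith [norm_nonneg a]
  have h1w : ‖(1 : P) + w‖ ≤ 2 := by
    have h1 : ‖(1 : P)‖ ≤ 1 := hnorm 1 0 (by simp) (by simp) (by simp)
    linarith [norm_add_le (1 : P) w]
  have hrw2 : ‖r * (1 + w)‖ ≤ 2 :=
    (norm_mul_le _ _).trans (by nlinarith [norm_nonneg r, norm_nonneg (1 + w)])
  have hcomm : (1 + w) * (1 - w) = (1 - w) * (1 + w) := by noncomm_ring
  have hrcomm : ∀ x ∈ X, ‖r * x - x * r‖ ≤ ε / 3 := by
    intro x hx
    have hwx := hwX x hx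
    have e : r * x - x * r = r * (x * w - w * x) * w * r + r * w * (x * w - w * x) * r := by
      calc r * x - x * r = r * x * ((1 + w * w) * r) - (r * (1 + w * w)) * x * r := by
            rw [hinv, hinv', mul_one, one_mul]
        _ = _ := by noncomm_ring
    have hxw : ‖x * w - w * x‖ ≤ ε / 6 := by rwa [norm_sub_rev]
    have b : ∀ a b c : P, ‖a‖ ≤ 1 → ‖b‖ ≤ ε / 6 → ‖c‖ ≤ 1 → ‖a * b * c‖ ≤ ε / 6 := by
      intro a b c ha hb hc
      calc ‖a * b * c‖ ≤ ‖a‖ * ‖b‖ * ‖c‖ :=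
            (norm_mul_le _ _).trans (mul_le_mul_of_nonneg_right (norm_mul_le _ _) (norm_nonneg _))
        _ ≤ 1 * (ε / 6) * 1 := by gcongr
        _ = ε / 6 := by ring
    have hwr : ‖w * r‖ ≤ 1 := (norm_mul_le _ _).trans (by nlinarith [norm_nonneg r, norm_nonneg w])
    have b1 := b r (x * w - w * x) (w * r) hr1 hxw hwr
    have b2 := b (r * w) (x * w - w * x) r (hrw ▸ hwr) hxw hr1
    rw [← mul_assoc] at b1
    rw [e]
    linarith [norm_add_le (r * (x * w - w * x) * w * r) (r * w * (x * w - w * x) * r)]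
  refine ⟨p, q, ?_, ?_, hps, hqs, hpq, hsum, hnorm p q hps hqs hsum,
    hnorm q p hqs hps (by rwa [add_comm]), fun x hx => ⟨?_, ?_⟩, fun x hx => ⟨?_, ?_⟩⟩
  · exact J.add_mem (J.mul_mem_left _ _ hwJ) (J.mul_mem_left _ _ hwJ)
  · have : 1 - q = (1 - r) + (1 - r) := by rw [hq]; abel
    rw [this, ← hrww]
    exact J.add_mem (J.mul_mem_left _ _ (J.mul_mem_left _ _ hwJ))
      (J.mul_mem_left _ _ (J.mul_mem_left _ _ hwJ))
  · rw [hq', mul_assoc]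
    refine (norm_mul_le _ _).trans ?_
    nlinarith [(hwK x hx).1, norm_nonneg (r * (1 + w)), norm_nonneg ((1 - w) * x)]
  · have hq2 : q = (1 - w) * (r * (1 + w)) := by
      have : (1 - w) * r = r * (1 - w) := by rw [sub_mul, mul_sub, hrw]; simp
      rw [hq', mul_assoc, hcomm, ← mul_assoc, ← this, mul_assoc]
    rw [hq2, ← mul_assoc]
    refine (norm_mul_le _ _).trans ?_
    nlinarith [(hwK x hx).2, norm_nonneg (r * (1 + w)), norm_nonneg (x * (1 - w))]
  · have e : p * x - x * p = 2 • (r * (w * x - x * w)) + 2 • ((r * x - x * r) * w) := by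
      rw [hp]; noncomm_ring
    have b1 : ‖r * (w * x - x * w)‖ ≤ ε / 6 := (norm_mul_le _ _).trans (by
      nlinarith [hwX x hx, norm_nonneg r, norm_nonneg (w * x - x * w)])
    have b2 : ‖(r * x - x * r) * w‖ ≤ ε / 3 := (norm_mul_le _ _).trans (by
      nlinarith [hrcomm x hx, norm_nonneg w, norm_nonneg (r * x - x * r)])
    rw [e, two_smul, two_smul]
    refine (norm_add_le _ _).trans ((add_le_add (norm_add_le _ _) (norm_add_le _ _)).trans ?_)
    linarith
  · have e : q * x - x * q = (r * x - x * r) + (r * x - x * r) := by rw [hq]; noncomm_ring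
    rw [e]
    refine (norm_add_le _ _).trans ?_
    linarith [hrcomm x hx]

/-- The algebraic estimate behind gluing: if `p, q` almost commute with `x, x', y, y'`, `q` almost
annihilates `j, j', k`, and `y, y'` agree with `x, x'` up to `j, j'` and up to small
errors, then the glued elements multiply with controlled error. -/
theorem norm_glue_mul_le {P : Type*} [CStarAlgebra P] {p q : P}
    (hp : star p = p) (hq : star q = q) (hpq : p * q = q * p) (h1 : p * p + q * q = 1)
    (hp1 : ‖p‖ ≤ 1) (hq1 : ‖q‖ ≤ 1) {x x' x'' y y' y'' j j' : P} {M δ η ε : ℝ}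
    (hx : ‖x‖ ≤ M) (hx' : ‖x'‖ ≤ M) (hy : ‖y‖ ≤ M) (hy' : ‖y'‖ ≤ M)
    (hr : ‖y - x - j‖ ≤ δ) (hr' : ‖y' - x' - j'‖ ≤ δ) (hη : ‖y'' - y * y'‖ ≤ η) (hδη : δ ^ 2 ≤ η)
    (hpx : ‖p * x - x * p‖ ≤ ε) (hpx' : ‖p * x' - x' * p‖ ≤ ε)
    (hqy : ‖q * y - y * q‖ ≤ ε) (hqy' : ‖q * y' - y' * q‖ ≤ ε)
    (hj : ‖q * j‖ ≤ ε) (hj' : ‖j' * q‖ ≤ ε) (hk : ‖q * (x'' - x * x')‖ ≤ ε) :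
    ‖(q * x'' * q + p * y'' * p) - (q * x * q + p * y * p) * (q * x' * q + p * y' * p)‖
      ≤ η + ε * (1 + 10 * M + δ) := by
  set r := y - x - j with hrd
  set r' := y' - x' - j' with hrd'
  have hM : 0 ≤ M := (norm_nonneg _).trans hx
  have hδ : 0 ≤ δ := (norm_nonneg _).trans hr
  have hmain : ‖p * (y'' - y * y') * p + q * (p * r * r' * p) * q‖ ≤ η := by
    refine norm_compression_le hp hq hpq h1 _ _ hη ?_
    calc ‖p * r * r' * p‖ ≤ ‖p‖ * ‖r‖ * ‖r'‖ * ‖p‖ := by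
          refine (norm_mul_le _ _).trans (mul_le_mul_of_nonneg_right ?_ (norm_nonneg _))
          refine (norm_mul_le _ _).trans (mul_le_mul_of_nonneg_right ?_ (norm_nonneg _))
          exact norm_mul_le _ _
      _ ≤ 1 * δ * δ * 1 := by gcongr
      _ ≤ η := by linarith
  have hqq : q * q = 1 - p * p := eq_sub_of_add_eq (by rw [add_comm]; exact h1)
  have hpp : p * p = 1 - q * q := eq_sub_of_add_eq h1
  have e1 : q * x * q * (q * x' * q) = q * x * x' * q - q * x * (p * p) * x' * q := by
    have : q * x * q * (q * x' * q) = q * x * (q * q) * x' * q := by noncomm_ring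
    rw [this, hqq]; noncomm_ring
  have e2 : p * y * p * (p * y' * p) = p * y * y' * p - p * y * (q * q) * y' * p := by
    have : p * y * p * (p * y' * p) = p * y * (p * p) * y' * p := by noncomm_ring
    rw [this, hpp]; noncomm_ring
  have e3 : q * x * q * (p * y' * p) = q * x * (p * q) * y' * p := by rw [hpq]; noncomm_ring
  have e4 : p * y * p * (q * x' * q) = p * y * (q * p) * x' * q := by rw [← hpq]; noncomm_ring
  have f1 : q * x * (p * p) * x' * q = q * p * (x * x') * (p * q)
      + (q * p * x * (p * x' - x' * p) * q - q * (p * x - x * p) * p * x' * q) := by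
    noncomm_ring
  have f2 : p * y * (q * q) * y' * p = q * p * (y * y') * (p * q)
      + (p * q * y * (q * y' - y' * q) * p - p * (q * y - y * q) * q * y' * p) := by
    have : q * p * (y * y') * (p * q) = p * q * (y * y') * (q * p) := by rw [hpq]
    rw [this]; noncomm_ring
  have f3 : q * x * (p * q) * y' * p = q * p * (x * y') * (p * q)
      + (q * p * x * (q * y' - y' * q) * p - q * (p * x - x * p) * q * y' * p) := by
    have : q * p * (x * y') * (p * q) = q * p * (x * y') * (q * p) := by rw [hpq]
    rw [this]; noncomm_ring
  have f4 : p * y * (q * p) * x' * q = q * p * (y * x') * (p * q)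
      + (p * q * y * (p * x' - x' * p) * q - p * (q * y - y * q) * p * x' * q) := by
    have : q * p * (y * x') * (p * q) = p * q * (y * x') * (p * q) := by rw [hpq]
    rw [this]; noncomm_ring
  have g : q * p * ((y - x) * (y' - x')) * (p * q) = q * (p * r * r' * p) * q
      + (p * (q * j) * (y' - x') * (p * q) + q * p * r * (j' * q) * p) := by
    have a1 : p * (q * j) = q * p * j := by rw [← mul_assoc, hpq]
    have a2 : q * p * r * (j' * q) * p = q * p * r * j' * (p * q) := by rw [hpq]; noncomm_ring
    rw [a1, a2, hrd, hrd']; noncomm_ring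
  have key : (q * x'' * q + p * y'' * p) - (q * x * q + p * y * p) * (q * x' * q + p * y' * p)
      = (p * (y'' - y * y') * p + q * (p * r * r' * p) * q)
        + (q * (x'' - x * x') * q
          + (p * (q * j) * (y' - x') * (p * q) + q * p * r * (j' * q) * p)
          + (q * p * x * (p * x' - x' * p) * q - q * (p * x - x * p) * p * x' * q)
          + (p * q * y * (q * y' - y' * q) * p - p * (q * y - y * q) * q * y' * p)
          - (q * p * x * (q * y' - y' * q) * p - q * (p * x - x * p) * q * y' * p)
          - (p * q * y * (p * x' - x' * p) * q - p * (q * y - y * q) * p * x' * q)) := by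
    have : (q * x'' * q + p * y'' * p) - (q * x * q + p * y * p) * (q * x' * q + p * y' * p)
      = q * x'' * q + p * y'' * p - q * x * q * (q * x' * q) - p * y * p * (p * y' * p)
        - q * x * q * (p * y' * p) - p * y * p * (q * x' * q) := by noncomm_ring
    rw [this, e1, e2, e3, e4, f1, f2, f3, f4]
    have g' := sub_eq_zero.2 g
    rw [← add_zero (p * (y'' - y * y') * p + q * (p * r * r' * p) * q), ← g']
    noncomm_ring
  have n1 : ∀ {a b : P} {s t : ℝ}, ‖a‖ ≤ s → ‖b‖ ≤ t → ‖a * b‖ ≤ s * t := fun ha hb =>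
    (norm_mul_le _ _).trans (mul_le_mul ha hb (norm_nonneg _) ((norm_nonneg _).trans ha))
  rw [key]
  refine (norm_add_le _ _).trans (add_le_add hmain ?_)
  have hyx : ‖y' - x'‖ ≤ M + M := (norm_sub_le _ _).trans (add_le_add hy' hx')
  have t0 := n1 hk hq1
  have t1 := n1 (n1 (n1 hp1 hj) hyx) (n1 hp1 hq1)
  have t2 := n1 (n1 (n1 (n1 hq1 hp1) hr) hj') hp1
  have t3 := n1 (n1 (n1 (n1 hq1 hp1) hx) hpx') hq1
  have t4 := n1 (n1 (n1 (n1 hq1 hpx) hp1) hx') hq1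
  have t5 := n1 (n1 (n1 (n1 hp1 hq1) hy) hqy') hp1
  have t6 := n1 (n1 (n1 (n1 hp1 hqy) hq1) hy') hp1
  have t7 := n1 (n1 (n1 (n1 hq1 hp1) hx) hqy') hp1
  have t8 := n1 (n1 (n1 (n1 hq1 hpx) hq1) hy') hp1
  have t9 := n1 (n1 (n1 (n1 hp1 hq1) hy) hpx') hq1
  have t10 := n1 (n1 (n1 (n1 hp1 hqy) hp1) hx') hq1
  have s1 : ∀ {a b : P} {s t : ℝ}, ‖a‖ ≤ s → ‖b‖ ≤ t → ‖a + b‖ ≤ s + t := fun ha hb =>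
    (norm_add_le _ _).trans (add_le_add ha hb)
  have s2 : ∀ {a b : P} {s t : ℝ}, ‖a‖ ≤ s → ‖b‖ ≤ t → ‖a - b‖ ≤ s + t := fun ha hb =>
    (norm_sub_le _ _).trans (add_le_add ha hb)
  refine (s2 (s2 (s1 (s1 (s1 t0 (s1 t1 t2)) (s2 t3 t4)) (s2 t5 t6)) (s2 t7 t8))
    (s2 t9 t10)).trans (le_of_eq ?_)
  ring

theorem exists_star_mul_self_add {D : Type*} [NonUnitalCStarAlgebra D] (z w : D) :
    ∃ v : D, star z * z + star w * w = star v * v := by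
  let _ : PartialOrder D := CStarAlgebra.spectralOrder D
  have : StarOrderedRing D := CStarAlgebra.spectralOrderedRing D
  exact CStarAlgebra.nonneg_iff_eq_star_mul_self.mp
    (add_nonneg (star_mul_self_nonneg z) (star_mul_self_nonneg w))

theorem Matrix.exists_star_mul_self_add {B : Type*} [NonUnitalCStarAlgebra B] {k : ℕ}
    (z w : Matrix (Fin k) (Fin k) B) :
    ∃ v : Matrix (Fin k) (Fin k) B, star z * z + star w * w = star v * v := by
  let _ : PartialOrder B := CStarAlgebra.spectralOrder B
  have : StarOrderedRing B := CStarAlgebra.spectralOrderedRing B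
  exact _root_.exists_star_mul_self_add (D := CStarMatrix (Fin k) (Fin k) B)
    (CStarMatrix.ofMatrix z) (CStarMatrix.ofMatrix w)

namespace IsCompletelyPositive

variable {A B C : Type*} [NonUnitalCStarAlgebra A] [NonUnitalCStarAlgebra B]
  [NonUnitalCStarAlgebra C] {φ : A → B}

theorem comp_starHom (hφ : IsCompletelyPositive φ) (f : C →⋆ₙₐ[ℂ] A) :
    IsCompletelyPositive fun c => φ (f c) := by
  refine ⟨fun a b => by simp [hφ.1], fun c a => by simp [hφ.2.1], ?_⟩
  rintro k x ⟨y, rfl⟩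
  obtain ⟨z, hz⟩ := hφ.2.2 k (star (y.map f) * y.map f) ⟨_, rfl⟩
  refine ⟨z, hz ▸ ?_⟩
  ext i j
  simp [Matrix.mul_apply, Matrix.star_apply, map_star]

theorem starHom_comp (hφ : IsCompletelyPositive φ) (f : B →⋆ₙₐ[ℂ] C) :
    IsCompletelyPositive fun a => f (φ a) := by
  refine ⟨fun a b => by simp [hφ.1], fun c a => by simp [hφ.2.1], ?_⟩
  intro k x hx
  obtain ⟨z, hz⟩ := hφ.2.2 k x hx
  refine ⟨z.map f, ?_⟩
  ext i j
  have := congrFun (congrFun hz i) j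
  simp only [Matrix.map_apply] at this
  simp [Matrix.mul_apply, Matrix.star_apply, this, map_star]

theorem comp_conj (hφ : IsCompletelyPositive φ) (d : A) :
    IsCompletelyPositive fun a => φ (star d * a * d) := by
  refine ⟨fun a b => by simp [mul_add, add_mul, hφ.1], fun c a => by
    simp [hφ.2.1, mul_smul_comm, smul_mul_assoc], ?_⟩
  rintro k x ⟨y, rfl⟩
  obtain ⟨z, hz⟩ := hφ.2.2 k (star (y.map (· * d)) * y.map (· * d)) ⟨_, rfl⟩
  refine ⟨z, hz ▸ ?_⟩
  ext i j
  simp [Matrix.mul_apply, Matrix.star_apply, Finset.mul_sum, Finset.sum_mul, mul_assoc]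

theorem conj_comp (hφ : IsCompletelyPositive φ) (d : B) :
    IsCompletelyPositive fun a => star d * φ a * d := by
  refine ⟨fun a b => by simp [mul_add, add_mul, hφ.1], fun c a => by
    simp [hφ.2.1, mul_smul_comm, smul_mul_assoc], ?_⟩
  intro k x hx
  obtain ⟨z, hz⟩ := hφ.2.2 k x hx
  refine ⟨z.map (· * d), ?_⟩
  ext i j
  have := congrFun (congrFun hz i) j
  simp only [Matrix.map_apply] at this
  simp [Matrix.mul_apply, Matrix.star_apply, this, Finset.mul_sum, Finset.sum_mul, mul_assoc]

theorem add {ψ : A → B} (hφ : IsCompletelyPositive φ) (hψ : IsCompletelyPositive ψ) :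
    IsCompletelyPositive fun a => φ a + ψ a := by
  refine ⟨fun a b => by simp only [hφ.1, hψ.1]; abel,
    fun c a => by simp [hφ.2.1, hψ.2.1], ?_⟩
  intro k x hx
  obtain ⟨z, hz⟩ := hφ.2.2 k x hx
  obtain ⟨w, hw⟩ := hψ.2.2 k x hx
  obtain ⟨v, hv⟩ := Matrix.exists_star_mul_self_add z w
  refine ⟨v, ?_⟩
  rw [← hv, ← hz, ← hw]
  rfl

theorem smul (hφ : IsCompletelyPositive φ) {s : ℝ} (hs : 0 ≤ s) :
    IsCompletelyPositive fun a => (s : ℂ) • φ a := by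
  refine ⟨fun a b => by simp [hφ.1], fun c a => by
    simp only [hφ.2.1]; exact smul_comm _ _ _, ?_⟩
  intro k x hx
  obtain ⟨z, hz⟩ := hφ.2.2 k x hx
  refine ⟨z.map (((√s : ℝ) : ℂ) • ·), ?_⟩
  have h : ((√s : ℝ) : ℂ) * ((√s : ℝ) : ℂ) = s := by
    rw [← Complex.ofReal_mul, Real.mul_self_sqrt hs]
  ext i j
  have := congrFun (congrFun hz i) j
  simp only [Matrix.map_apply] at this
  simp [Matrix.mul_apply, Matrix.star_apply, this, Finset.smul_sum, smul_mul_smul_comm, ← h, -Complex.coe_smul, -Complex.ofReal_mul]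

theorem exists_star_mul_self (hφ : IsCompletelyPositive φ) (a : A) :
    ∃ b, φ (star a * a) = star b * b := by
  obtain ⟨z, hz⟩ := hφ.2.2 1 (star !![a] * !![a]) ⟨_, rfl⟩
  refine ⟨z 0 0, ?_⟩
  have := congrFun (congrFun hz 0) 0
  simpa [Matrix.mul_apply, Matrix.star_apply] using this

protected theorem map_star (hφ : IsCompletelyPositive φ) (a : A) : φ (star a) = star (φ a) := by
  let _ : PartialOrder A := CStarAlgebra.spectralOrder A
  have : StarOrderedRing A := CStarAlgebra.spectralOrderedRing A
  have hpos : ∀ y : A, 0 ≤ y → star (φ y) = φ y := by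
    intro y hy
    obtain ⟨x, rfl⟩ := CStarAlgebra.nonneg_iff_eq_star_mul_self.mp hy
    obtain ⟨b, hb⟩ := hφ.exists_star_mul_self x
    rw [hb]; simp
  obtain ⟨y, hy, -, h⟩ := CStarAlgebra.exists_sum_four_nonneg a
  rw [h]
  have hneg : ∀ y, φ (-y) = -φ y := fun y => by simpa using hφ.2.1 (-1) y
  have hy' : ∀ i, star (y i) = y i := fun i => (IsSelfAdjoint.of_nonneg (hy i)).star_eq
  simp [Fin.sum_univ_four, hφ.1, hφ.2.1, hneg, hpos _ (hy _), hy', pow_succ]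

theorem exists_norm_le (hφ : IsCompletelyPositive φ) : ∃ K : ℝ, 0 ≤ K ∧ ∀ a, ‖φ a‖ ≤ K * ‖a‖ := by
  let _ : PartialOrder A := CStarAlgebra.spectralOrder A
  have : StarOrderedRing A := CStarAlgebra.spectralOrderedRing A
  let _ : PartialOrder B := CStarAlgebra.spectralOrder B
  have : StarOrderedRing B := CStarAlgebra.spectralOrderedRing B
  let f : A →ₚ[ℂ] B := PositiveLinearMap.mk₀
    { toFun := φ, map_add' := hφ.1, map_smul' := hφ.2.1 } fun y hy => by
      obtain ⟨x, rfl⟩ := CStarAlgebra.nonneg_iff_eq_star_mul_self.mp hy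
      obtain ⟨b, hb⟩ := hφ.exists_star_mul_self x
      exact (star_mul_self_nonneg b).trans_eq hb.symm
  obtain ⟨K, hK⟩ := f.exists_norm_apply_le
  exact ⟨K, K.2, hK⟩

theorem norm_star_mul_sq_le (hφ : IsCompletelyPositive φ) (x y : A) :
    ‖φ (star x * y)‖ ^ 2 ≤ ‖φ (star x * x)‖ * ‖φ (star y * y)‖ := by
  let _ : PartialOrder B := CStarAlgebra.spectralOrder B
  have : StarOrderedRing B := CStarAlgebra.spectralOrderedRing B
  obtain ⟨z, hz⟩ := hφ.2.2 2 (star !![x, y; 0, 0] * !![x, y; 0, 0]) ⟨_, rfl⟩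
  let u : Fin 2 → WithCStarModule B (Fin 2 → B) :=
    fun j => (WithCStarModule.equiv B _).symm fun i => star (z i j)
  have hu : ∀ i j, inner B (u i) (u j) = (star z * z) j i := by
    intro i j
    simp [WithCStarModule.pi_inner, Matrix.mul_apply, Matrix.star_apply, u,
      WithCStarModule.inner_def]
  have h00 : φ (star x * x) = inner B (u 0) (u 0) := by
    rw [hu, ← hz]; simp [Matrix.mul_apply, Matrix.star_apply]
  have h01 : φ (star x * y) = inner B (u 1) (u 0) := by
    rw [hu, ← hz]; simp [Matrix.mul_apply, Matrix.star_apply]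
  have h11 : φ (star y * y) = inner B (u 1) (u 1) := by
    rw [hu, ← hz]; simp [Matrix.mul_apply, Matrix.star_apply]
  rw [h00, h01, h11, ← CStarModule.norm_sq_eq B, ← CStarModule.norm_sq_eq B, ← mul_pow, mul_comm ‖u 0‖]
  gcongr
  exact CStarModule.norm_inner_le _

theorem norm_mono (hφ : IsCompletelyPositive φ) {s : ℝ} (x w v : A)
    (h : (s : ℂ) • (star x * x) = star w * w + star v * v) :
    ‖φ (star w * w)‖ ≤ |s| * ‖φ (star x * x)‖ := by
  let _ : PartialOrder B := CStarAlgebra.spectralOrder B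
  have : StarOrderedRing B := CStarAlgebra.spectralOrderedRing B
  obtain ⟨b, hb⟩ := hφ.exists_star_mul_self w
  obtain ⟨c, hc⟩ := hφ.exists_star_mul_self v
  have h1 := congrArg φ h
  rw [hφ.2.1, hφ.1] at h1
  calc _ ≤ ‖(s : ℂ) • φ (star x * x)‖ := by
        rw [h1, hb, hc]
        refine CStarAlgebra.norm_le_norm_of_nonneg_of_le (star_mul_self_nonneg b) ?_
        exact le_add_of_nonneg_right (star_mul_self_nonneg c)
    _ = _ := by rw [norm_smul]; simp

theorem norm_conj_le (hφ : IsCompletelyPositive φ) {d : A} (hd : star d = d) (a : A) :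
    ‖φ (d * a * d)‖ ≤ ‖a‖ * ‖φ (d * d)‖ := by
  let _ : PartialOrder A := CStarAlgebra.spectralOrder A
  have : StarOrderedRing A := CStarAlgebra.spectralOrderedRing A
  have h1 : star (a * d) * (a * d) ≤ ‖a‖ ^ 2 • (star d * d) := by
    have h := CStarAlgebra.star_left_conjugate_le_norm_smul (a := d) (b := star a * a)
      (IsSelfAdjoint.star_mul_self a)
    rw [CStarRing.norm_star_mul_self, ← sq] at h
    simpa [mul_assoc] using h
  obtain ⟨v, hv⟩ := CStarAlgebra.nonneg_iff_eq_star_mul_self.mp (sub_nonneg.mpr h1)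
  have h2 := hφ.norm_mono (s := ‖a‖ ^ 2) d (a * d) v (by rw [← hv, Complex.coe_smul]; abel)
  have h3 := hφ.norm_star_mul_sq_le d (a * d)
  rw [abs_of_nonneg (by positivity)] at h2
  rw [hd, ← mul_assoc] at h3
  rw [hd] at h2
  refine abs_le_of_sq_le_sq' ?_ (by positivity) |>.2
  calc _ ≤ _ := h3
    _ ≤ _ := mul_le_mul_of_nonneg_left h2 (norm_nonneg _)
    _ = _ := by ring

end IsCompletelyPositive

/-- Interpolating, by a quasicentral partition of unity, between a cp map that is multiplicative
modulo `J` and a nearby (modulo `J`) almost multiplicative cp map. -/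
theorem exists_cp_glue {P A : Type*} [CStarAlgebra P] [NonUnitalCStarAlgebra A]
    (J : TwoSidedIdeal P) (hJ : ∀ x ∈ J, star x ∈ J) {F Φ : A → P}
    (hF : IsCompletelyPositive F) (hΦ : IsCompletelyPositive Φ)
    (hFJ : ∀ a b, F (a * b) - F a * F b ∈ J) (G : Finset A) {δ η ε : ℝ} (hδη : δ ^ 2 ≤ η)
    (hclose : ∀ a ∈ G, ∃ j ∈ J, ‖Φ a - F a - j‖ ≤ δ)
    (hmul : ∀ a ∈ G, ∀ b ∈ G, ‖Φ (a * b) - Φ a * Φ b‖ ≤ η) (hε : 0 < ε) :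
    ∃ Ψ : A → P, IsCompletelyPositive Ψ ∧ (∀ a, Ψ a - F a ∈ J) ∧
      (∀ a ∈ G, ∀ b ∈ G, ‖Ψ (a * b) - Ψ a * Ψ b‖ ≤ η + ε) ∧
      ∀ a, ‖Ψ a‖ ≤ max ‖F a‖ ‖Φ a‖ := by
  classical
  choose! j hjJ hj using hclose
  obtain ⟨M, hM0, hM⟩ : ∃ M : ℝ, 0 ≤ M ∧ ∀ a ∈ G, ‖F a‖ ≤ M ∧ ‖Φ a‖ ≤ M := by
    refine ⟨∑ a ∈ G, (‖F a‖ + ‖Φ a‖), Finset.sum_nonneg fun a _ => by positivity,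
      fun a ha => ?_⟩
    have h := Finset.single_le_sum (f := fun a => ‖F a‖ + ‖Φ a‖)
      (fun a _ => by positivity) ha
    constructor <;> linarith [norm_nonneg (F a), norm_nonneg (Φ a)]
  obtain rfl | ⟨a₀, ha₀⟩ := G.eq_empty_or_nonempty
  · exact ⟨F, hF, fun a => by simp [J.zero_mem], by simp, fun a => le_max_left _ _⟩
  have hδ0 : 0 ≤ δ := (norm_nonneg _).trans (hj a₀ ha₀)
  set κ := ε / (1 + 10 * M + δ) with hκ
  have hden : 0 < 1 + 10 * M + δ := by positivity
  have hκ0 : 0 < κ := by positivity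
  let K : Finset P := G.image j ∪ (G ×ˢ G).image fun ab => F (ab.1 * ab.2) - F ab.1 * F ab.2
  let X : Finset P := G.image F ∪ G.image Φ
  have hK : ∀ x ∈ K, x ∈ J := by
    intro x hx
    rcases Finset.mem_union.mp hx with hx | hx
    · obtain ⟨a, ha, rfl⟩ := Finset.mem_image.mp hx
      exact hjJ a ha
    · obtain ⟨a, -, rfl⟩ := Finset.mem_image.mp hx
      exact hFJ _ _
  obtain ⟨p, q, hpJ, hqJ, hp, hq, hpq, h1, hp1, hq1, hKq, hX⟩ :=
    exists_quasicentral_partition J hJ K hK X hκ0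
  have hjK : ∀ a ∈ G, j a ∈ K := fun a ha =>
    Finset.mem_union_left _ (Finset.mem_image_of_mem _ ha)
  have hFX : ∀ a ∈ G, F a ∈ X := fun a ha =>
    Finset.mem_union_left _ (Finset.mem_image_of_mem _ ha)
  have hΦX : ∀ a ∈ G, Φ a ∈ X := fun a ha =>
    Finset.mem_union_right _ (Finset.mem_image_of_mem _ ha)
  refine ⟨fun a => q * F a * q + p * Φ a * p, ?_, fun a => ?_, fun a ha b hb => ?_, fun a => ?_⟩
  · simpa only [hp, hq] using (hF.conj_comp q).add (hΦ.conj_comp p)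
  · have : q * F a * q + p * Φ a * p - F a =
        p * (Φ a * p) - ((1 - q) * (F a * q) + F a * (1 - q)) := by noncomm_ring
    rw [this]
    exact J.sub_mem (J.mul_mem_right _ _ hpJ)
      (J.add_mem (J.mul_mem_right _ _ hqJ) (J.mul_mem_left _ _ hqJ))
  · have h := norm_glue_mul_le hp hq hpq h1 hp1 hq1 (hM a ha).1 (hM b hb).1 (hM a ha).2 (hM b hb).2
      (hj a ha) (hj b hb)
      (hmul a ha b hb) hδη (hX _ (hFX a ha)).1 (hX _ (hFX b hb)).1 (hX _ (hΦX a ha)).2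
      (hX _ (hΦX b hb)).2 (hKq _ (hjK a ha)).1 (hKq _ (hjK b hb)).2
      (hKq (F (a * b) - F a * F b) (Finset.mem_union_right _
        (Finset.mem_image.mpr ⟨(a, b), Finset.mk_mem_product ha hb, rfl⟩))).1
    refine h.trans_eq ?_
    rw [hκ, div_mul_cancel₀ _ hden.ne']
  · change ‖q * F a * q + p * Φ a * p‖ ≤ _
    rw [add_comm]
    exact norm_compression_le hp hq hpq h1 _ _ (le_max_right _ _) (le_max_left _ _)

theorem exists_cp_glue_chain {P A : Type*} [CStarAlgebra P] [NonUnitalCStarAlgebra A]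
    (J : TwoSidedIdeal P) (hJ : ∀ x ∈ J, star x ∈ J) {F : ℕ → A → P} {Φ : A → P}
    (hF : ∀ i, IsCompletelyPositive (F i)) (hΦ : IsCompletelyPositive Φ)
    (hFJ : ∀ i a b, F i (a * b) - F i a * F i b ∈ J) (G : Finset A) {δ η : ℝ}
    (hδη : δ ^ 2 ≤ η) (hΦF : ∀ a ∈ G, ∃ j ∈ J, ‖Φ a - F 0 a - j‖ ≤ δ)
    (hFF : ∀ i, ∀ a ∈ G, ‖F i a - F (i + 1) a‖ ≤ δ)
    (hmul : ∀ a ∈ G, ∀ b ∈ G, ‖Φ (a * b) - Φ a * Φ b‖ ≤ η) (M : A → ℝ)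
    (hΦM : ∀ a, ‖Φ a‖ ≤ M a) (hFM : ∀ i a, ‖F i a‖ ≤ M a) (i : ℕ) {ε : ℝ} (hε : 0 < ε) :
    ∃ Ψ : A → P, IsCompletelyPositive Ψ ∧ (∀ a, Ψ a - F i a ∈ J) ∧
      (∀ a ∈ G, ∀ b ∈ G, ‖Ψ (a * b) - Ψ a * Ψ b‖ ≤ η + ε) ∧ ∀ a, ‖Ψ a‖ ≤ M a := by
  induction i generalizing ε with
  | zero =>
    obtain ⟨Ψ, h1, h2, h3, h4⟩ := exists_cp_glue J hJ (hF 0) hΦ (hFJ 0) G hδη hΦF hmul hε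
    exact ⟨Ψ, h1, h2, h3, fun a => (h4 a).trans (max_le (hFM 0 a) (hΦM a))⟩
  | succ i ih =>
    obtain ⟨Ψ, h1, h2, h3, h4⟩ := ih (half_pos hε)
    obtain ⟨Ψ', h1', h2', h3', h4'⟩ := exists_cp_glue J hJ (hF (i + 1)) h1 (hFJ (i + 1)) G
      (δ := δ) (η := η + ε / 2) (by linarith)
      (fun a ha => ⟨Ψ a - F i a, h2 a, by
        rw [show Ψ a - F (i + 1) a - (Ψ a - F i a) = F i a - F (i + 1) a by abel]
        exact hFF i a ha⟩) h3 (half_pos hε)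
    exact ⟨Ψ', h1', h2', fun a ha b hb => (h3' a ha b hb).trans_eq (by ring),
      fun a => (h4' a).trans (max_le (hFM _ a) (h4 a))⟩

section MatTrace

variable {n : ℕ}

theorem matTrace_eq_sum (T : MatAlg n) :
    matTrace n T = (∑ i, inner ℂ (EuclideanSpace.basisFun (Fin n) ℂ i)
      (T (EuclideanSpace.basisFun (Fin n) ℂ i))) / n := by
  rw [matTrace, LinearMap.trace_eq_sum_inner _ (EuclideanSpace.basisFun (Fin n) ℂ)]
  rfl

theorem re_matTrace_star_mul_self (T : MatAlg n) :
    (matTrace n (star T * T)).re = (∑ i, ‖T (EuclideanSpace.basisFun (Fin n) ℂ i)‖ ^ 2) / n := by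
  rw [matTrace_eq_sum, ← Complex.ofReal_natCast, Complex.div_ofReal_re, Complex.re_sum]
  congr 1
  refine Finset.sum_congr rfl fun i _ => ?_
  rw [mul_apply_eq_comp, ContinuousLinearMap.star_eq_adjoint,
    ContinuousLinearMap.adjoint_inner_right, inner_self_eq_norm_sq_to_K]
  norm_cast

theorem matTrace_sub (S T : MatAlg n) : matTrace n (S - T) = matTrace n S - matTrace n T := by
  simp [matTrace, sub_div]

theorem matTrace_add (S T : MatAlg n) : matTrace n (S + T) = matTrace n S + matTrace n T := by
  simp [matTrace, add_div]

theorem matTrace_mul_comm (S T : MatAlg n) : matTrace n (S * T) = matTrace n (T * S) := by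
  simp only [matTrace]
  congr 1
  exact LinearMap.trace_mul_comm ℂ _ _

theorem norm_basisFun (i : Fin n) : ‖EuclideanSpace.basisFun (Fin n) ℂ i‖ = 1 :=
  (EuclideanSpace.basisFun (Fin n) ℂ).orthonormal.1 i

theorem norm_apply_basisFun_le (T : MatAlg n) (i : Fin n) :
    ‖T (EuclideanSpace.basisFun (Fin n) ℂ i)‖ ≤ ‖T‖ := by
  simpa [norm_basisFun] using T.le_opNorm (EuclideanSpace.basisFun (Fin n) ℂ i)

theorem re_matTrace_star_mul_self_nonneg (T : MatAlg n) : 0 ≤ (matTrace n (star T * T)).re := by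
  rw [re_matTrace_star_mul_self]
  positivity

theorem re_matTrace_mul_le (S T : MatAlg n) :
    (matTrace n (star (S * T) * (S * T))).re ≤ ‖S‖ ^ 2 * (matTrace n (star T * T)).re := by
  rw [re_matTrace_star_mul_self, re_matTrace_star_mul_self, ← mul_div_assoc, Finset.mul_sum]
  gcongr with i
  rw [← mul_pow]
  gcongr
  exact S.le_opNorm _

theorem re_matTrace_star (T : MatAlg n) :
    (matTrace n (star (star T) * star T)).re = (matTrace n (star T * T)).re := by
  rw [star_star, matTrace_mul_comm]

theorem re_matTrace_add_le (S T : MatAlg n) :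
    (matTrace n (star (S + T) * (S + T))).re ≤
      2 * (matTrace n (star S * S)).re + 2 * (matTrace n (star T * T)).re := by
  simp only [re_matTrace_star_mul_self]
  rw [← mul_div_assoc, ← mul_div_assoc, ← add_div, Finset.mul_sum, Finset.mul_sum,
    ← Finset.sum_add_distrib]
  gcongr with i
  rw [add_apply]
  have h := norm_add_le (S (EuclideanSpace.basisFun (Fin n) ℂ i))
    (T (EuclideanSpace.basisFun (Fin n) ℂ i))
  nlinarith [sq_nonneg (‖S (EuclideanSpace.basisFun (Fin n) ℂ i)‖ -
    ‖T (EuclideanSpace.basisFun (Fin n) ℂ i)‖), norm_nonneg (S (EuclideanSpace.basisFun (Fin n) ℂ i)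
      + T (EuclideanSpace.basisFun (Fin n) ℂ i))]

theorem re_matTrace_le_norm_sq (T : MatAlg n) : (matTrace n (star T * T)).re ≤ ‖T‖ ^ 2 := by
  rw [re_matTrace_star_mul_self]
  refine div_le_of_le_mul₀ (by positivity) (by positivity) ?_
  calc _ ≤ ∑ _i : Fin n, ‖T‖ ^ 2 := by
        gcongr with i
        exact norm_apply_basisFun_le T i
    _ = _ := by simp [mul_comm]

theorem norm_matTrace_sq_le (T : MatAlg n) :
    ‖matTrace n T‖ ^ 2 ≤ (matTrace n (star T * T)).re := by
  rcases Nat.eq_zero_or_pos n with rfl | hn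
  · simp [matTrace]
  have hn' : (0 : ℝ) < n := by exact_mod_cast hn
  rw [re_matTrace_star_mul_self, matTrace_eq_sum, norm_div, div_pow, Complex.norm_natCast,
    div_le_div_iff₀ (by positivity) hn']
  have h1 : ‖∑ i, inner ℂ (EuclideanSpace.basisFun (Fin n) ℂ i)
      (T (EuclideanSpace.basisFun (Fin n) ℂ i))‖ ≤
      ∑ i, ‖T (EuclideanSpace.basisFun (Fin n) ℂ i)‖ := by
    refine (norm_sum_le _ _).trans (Finset.sum_le_sum fun i _ => ?_)
    simpa [norm_basisFun] using norm_inner_le_norm (𝕜 := ℂ) (EuclideanSpace.basisFun (Fin n) ℂ i)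
      (T (EuclideanSpace.basisFun (Fin n) ℂ i))
  have h2 := sq_sum_le_card_mul_sum_sq (s := Finset.univ)
    (f := fun i => ‖T (EuclideanSpace.basisFun (Fin n) ℂ i)‖)
  rw [Finset.card_univ, Fintype.card_fin] at h2
  have h3 := (pow_le_pow_left₀ (norm_nonneg _) h1 2).trans h2
  calc _ ≤ (n * ∑ i, ‖T (EuclideanSpace.basisFun (Fin n) ℂ i)‖ ^ 2) * n := by gcongr
    _ = _ := by ring

theorem norm_matTrace_le (T : MatAlg n) : ‖matTrace n T‖ ≤ ‖T‖ :=
  abs_le_of_sq_le_sq' ((norm_matTrace_sq_le T).trans (re_matTrace_le_norm_sq T))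
    (norm_nonneg T) |>.2

end MatTrace

theorem memℓp_const_one : Memℓp (fun n => (1 : MatAlg n)) ∞ :=
  memℓp_infty ⟨1, by
    rintro _ ⟨n, rfl⟩
    exact ContinuousLinearMap.norm_id_le⟩

/-- The C*-algebra `∏ₙ M_n`. -/
abbrev MatProd := lp (fun n => MatAlg n) ∞

instance : NonUnitalNormedRing MatProd := inferInstance
instance : NormedAddCommGroup MatProd := inferInstance
instance : NormedSpace ℂ MatProd := inferInstance
instance : NonUnitalRing MatProd := inferInstance
instance : AddCommGroup MatProd := inferInstance
instance : StarRing MatProd := inferInstance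
instance : Module ℂ MatProd := inferInstance

/-- The unital C*-algebra structure on `∏ₙ M_n`. -/
abbrev matProdCStarAlgebra : CStarAlgebra MatProd :=
  let S : NonUnitalCStarAlgebra MatProd := inferInstance
  let one : lp (fun n => MatAlg n) ∞ := ⟨fun n => (1 : MatAlg n), memℓp_const_one⟩
  let R : Ring MatProd :=
    { S with
      one := one
      one_mul := fun x => by
        ext n : 2
        exact one_mul (x n)
      mul_one := fun x => by
        ext n : 2
        exact mul_one (x n) }
  let alg : Algebra ℂ MatProd :=
    Algebra.ofModule (fun r x y => smul_mul_assoc r x y) (fun r x y => mul_smul_comm r x y)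
  { S, R, alg with }

theorem neg_star_mul_neg {R : Type*} [NonUnitalRing R] [StarRing R] (x : R) :
    star (-x) * -x = star x * x := by
  rw [star_neg, neg_mul_neg]

namespace twoOmegaMem

variable {ω : Ultrafilter ℕ} {x y : MatProd}

theorem of_le {c d : ℝ} (hx : twoOmegaMem ω x) (hy : twoOmegaMem ω y) {z : MatProd}
    (h : ∀ n, (matTrace n (star (z n) * z n)).re ≤
      c * (matTrace n (star (x n) * x n)).re + d * (matTrace n (star (y n) * y n)).re) :
    twoOmegaMem ω z := by
  refine tendsto_of_tendsto_of_tendsto_of_le_of_le tendsto_const_nhds ?_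
    (fun n => re_matTrace_star_mul_self_nonneg _) h
  simpa using (Tendsto.const_mul c hx).add (Tendsto.const_mul d hy)

theorem zero : twoOmegaMem ω 0 := by
  have : ∀ n, ((0 : MatProd) n) = 0 := fun n => rfl
  simp [twoOmegaMem, this, matTrace]

theorem add (hx : twoOmegaMem ω x) (hy : twoOmegaMem ω y) : twoOmegaMem ω (x + y) :=
  hx.of_le hy (c := 2) (d := 2) fun n => re_matTrace_add_le (x n) (y n)

theorem mul_left (z : MatProd) (hx : twoOmegaMem ω x) : twoOmegaMem ω (z * x) :=
  hx.of_le hx (c := ‖z‖ ^ 2) (d := 0) fun n => by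
    refine (re_matTrace_mul_le (z n) (x n)).trans ?_
    rw [zero_mul, add_zero]
    exact mul_le_mul_of_nonneg_right (pow_le_pow_left₀ (norm_nonneg _)
      (lp.norm_apply_le_norm ENNReal.top_ne_zero z n) 2) (re_matTrace_star_mul_self_nonneg _)

theorem star (hx : twoOmegaMem ω x) : twoOmegaMem ω (star x) :=
  hx.of_le hx (c := 1) (d := 0) fun n => by
    simpa using (re_matTrace_star (x n)).le

theorem mul_right (z : MatProd) (hx : twoOmegaMem ω x) : twoOmegaMem ω (x * z) := by
  simpa using (hx.star.mul_left (Star.star z)).star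

theorem neg (hx : twoOmegaMem ω x) : twoOmegaMem ω (-x) :=
  hx.of_le hx (c := 1) (d := 0) fun n => by
    rw [one_mul, zero_mul, add_zero]
    exact (congrArg (fun T => (matTrace n T).re) (neg_star_mul_neg (x n))).le

theorem sub (hx : twoOmegaMem ω x) (hy : twoOmegaMem ω y) : twoOmegaMem ω (x - y) := by
  rw [sub_eq_add_neg]
  exact hx.add hy.neg

theorem of_forall_approx (h : ∀ ε > 0, ∃ j, twoOmegaMem ω j ∧ ‖x - j‖ ≤ ε) : twoOmegaMem ω x := by
  refine Metric.tendsto_nhds.mpr fun ε hε => ?_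
  obtain ⟨j, hj, hxj⟩ := h (√(ε / 4)) (by positivity)
  filter_upwards [(Metric.tendsto_nhds.mp hj) (ε / 4) (by positivity)] with n hn
  rw [Real.dist_eq, sub_zero, abs_of_nonneg (re_matTrace_star_mul_self_nonneg _)] at hn ⊢
  have h1 := re_matTrace_add_le (x n - j n) (j n)
  have h2 := re_matTrace_le_norm_sq (x n - j n)
  have h3 : ‖x n - j n‖ ≤ √(ε / 4) :=
    (lp.norm_apply_le_norm ENNReal.top_ne_zero (x - j) n).trans hxj
  have h4 := pow_le_pow_left₀ (norm_nonneg _) h3 2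
  rw [Real.sq_sqrt (by positivity)] at h4
  rw [sub_add_cancel] at h1
  linarith

end twoOmegaMem

theorem exists_of_quotNorm_lt {ω : Ultrafilter ℕ} {x : MatProd} {r : ℝ} (h : quotNorm ω x < r) :
    ∃ j, twoOmegaMem ω j ∧ ‖x + j‖ < r := by
  have h0 : {r : ℝ | ∃ j, twoOmegaMem ω j ∧ r = ‖x + j‖}.Nonempty :=
    ⟨‖x + 0‖, 0, twoOmegaMem.zero, rfl⟩
  obtain ⟨_, ⟨j, hj, rfl⟩, hr⟩ := exists_lt_of_csInf_lt h0 h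
  exact ⟨j, hj, hr⟩

theorem twoOmegaMem.quotNorm_eq_zero {ω : Ultrafilter ℕ} {x : MatProd} (hx : twoOmegaMem ω x) :
    quotNorm ω x = 0 := by
  have h0 : (0 : ℝ) ∈ {r : ℝ | ∃ j, twoOmegaMem ω j ∧ r = ‖x + j‖} := ⟨-x, hx.neg, by simp⟩
  refine le_antisymm (csInf_le ⟨0, ?_⟩ h0) (Real.sInf_nonneg ?_)
  · rintro _ ⟨j, -, rfl⟩
    exact norm_nonneg _
  · rintro _ ⟨j, -, rfl⟩
    exact norm_nonneg _

/-- The ideal `⊕_{2,ω} M_n` of `∏ₙ M_n`. -/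
def twoOmegaIdeal (ω : Ultrafilter ℕ) : TwoSidedIdeal MatProd :=
  TwoSidedIdeal.mk' {x | twoOmegaMem ω x} twoOmegaMem.zero twoOmegaMem.add twoOmegaMem.neg
    (fun h => h.mul_left _) (fun h => h.mul_right _)

theorem mem_twoOmegaIdeal {ω : Ultrafilter ℕ} {x : MatProd} :
    x ∈ twoOmegaIdeal ω ↔ twoOmegaMem ω x :=
  TwoSidedIdeal.mem_mk' _ _ _ _ _ _ _

theorem exists_cp_matProd_glue_chain {A : Type*} [NonUnitalCStarAlgebra A] (ω : Ultrafilter ℕ)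
    {F : ℕ → A → MatProd} {Φ : A → MatProd}
    (hF : ∀ i, IsCompletelyPositive (F i)) (hΦ : IsCompletelyPositive Φ)
    (hFJ : ∀ i a b, twoOmegaMem ω (F i (a * b) - F i a * F i b)) (G : Finset A) {δ η : ℝ}
    (hδη : δ ^ 2 ≤ η) (hΦF : ∀ a ∈ G, ∃ j, twoOmegaMem ω j ∧ ‖Φ a - F 0 a - j‖ ≤ δ)
    (hFF : ∀ i, ∀ a ∈ G, ‖F i a - F (i + 1) a‖ ≤ δ)
    (hmul : ∀ a ∈ G, ∀ b ∈ G, ‖Φ (a * b) - Φ a * Φ b‖ ≤ η) (M : A → ℝ)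
    (hΦM : ∀ a, ‖Φ a‖ ≤ M a) (hFM : ∀ i a, ‖F i a‖ ≤ M a) (i : ℕ) {ε : ℝ} (hε : 0 < ε) :
    ∃ Ψ : A → MatProd, IsCompletelyPositive Ψ ∧ (∀ a, twoOmegaMem ω (Ψ a - F i a)) ∧
      (∀ a ∈ G, ∀ b ∈ G, ‖Ψ (a * b) - Ψ a * Ψ b‖ ≤ η + ε) ∧ ∀ a, ‖Ψ a‖ ≤ M a := by
  have h := @exists_cp_glue_chain MatProd A matProdCStarAlgebra _ (twoOmegaIdeal ω)
    (fun x hx => mem_twoOmegaIdeal.mpr (mem_twoOmegaIdeal.mp hx).star) F Φ hF hΦ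
    (fun i a b => mem_twoOmegaIdeal.mpr (hFJ i a b)) G δ η hδη
    (fun a ha => by
      obtain ⟨j, hj, h⟩ := hΦF a ha
      exact ⟨j, mem_twoOmegaIdeal.mpr hj, h⟩) hFF hmul M hΦM hFM i ε hε
  obtain ⟨Ψ, h1, h2, h3, h4⟩ := h
  exact ⟨Ψ, h1, fun a => mem_twoOmegaIdeal.mp (h2 a), h3, h4⟩

theorem IsCompletelyPositive.map_sub {A B : Type*} [NonUnitalCStarAlgebra A]
    [NonUnitalCStarAlgebra B] {φ : A → B} (hφ : IsCompletelyPositive φ) (a b : A) :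
    φ (a - b) = φ a - φ b := by
  rw [sub_eq_add_neg, hφ.1, ← neg_one_smul ℂ b, hφ.2.1, neg_one_smul, ← sub_eq_add_neg]

theorem IsCompletelyPositive.norm_mul_defect_sub_le {A B : Type*} [NonUnitalCStarAlgebra A]
    [NonUnitalCStarAlgebra B] {φ : A → B} (hφ : IsCompletelyPositive φ) {K : ℝ} (hK : 0 ≤ K)
    (hφK : ∀ a, ‖φ a‖ ≤ K * ‖a‖) (a b a' b' : A) :
    ‖(φ (a * b) - φ a * φ b) - (φ (a' * b') - φ a' * φ b')‖ ≤
      (K + K ^ 2) * (‖a - a'‖ * ‖b‖ + ‖a'‖ * ‖b - b'‖) := by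
  have h1 : (φ (a * b) - φ a * φ b) - (φ (a' * b') - φ a' * φ b') =
      φ ((a - a') * b + a' * (b - b')) - (φ (a - a') * φ b + φ a' * φ (b - b')) := by
    rw [hφ.1, sub_mul, mul_sub, hφ.map_sub, hφ.map_sub, hφ.map_sub, hφ.map_sub, sub_mul, mul_sub]
    abel
  have h2 : ‖φ ((a - a') * b + a' * (b - b'))‖ ≤
      K * (‖a - a'‖ * ‖b‖ + ‖a'‖ * ‖b - b'‖) :=
    (hφK _).trans (mul_le_mul_of_nonneg_left ((norm_add_le _ _).trans
      (add_le_add (norm_mul_le _ _) (norm_mul_le _ _))) hK)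
  have h3 : ∀ x y, ‖φ x * φ y‖ ≤ K ^ 2 * (‖x‖ * ‖y‖) := fun x y =>
    calc ‖φ x * φ y‖ ≤ (K * ‖x‖) * (K * ‖y‖) := (norm_mul_le _ _).trans (by gcongr <;> apply hφK)
      _ = _ := by ring
  rw [h1]
  refine (norm_sub_le _ _).trans ((add_le_add h2 ((norm_add_le _ _).trans
    (add_le_add (h3 _ _) (h3 _ _)))).trans_eq ?_)
  ring

/-- Small perturbations of `a` and `b` within a dense set change the multiplicativity defect of
a bounded cp map by little, uniformly in its norm. -/
theorem exists_norm_mul_defect_sub_le {A : Type*} [NonUnitalCStarAlgebra A] {d : ℕ → A}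
    (hd : DenseRange d) {K : ℝ} (hK : 0 ≤ K) (a b : A) {ε : ℝ} (hε : 0 < ε) :
    ∃ i j, (K + K ^ 2) * (‖a - d i‖ * ‖b‖ + ‖d i‖ * ‖b - d j‖) ≤ ε := by
  have hL : 0 < (K + K ^ 2) * (‖a‖ + ‖b‖ + 1) + 1 := by positivity
  set L := (K + K ^ 2) * (‖a‖ + ‖b‖ + 1) + 1 with hLd
  set ρ := min 1 (ε / L) with hρ
  have hρ0 : 0 < ρ := lt_min one_pos (by positivity)
  obtain ⟨i, hi⟩ := hd.exists_dist_lt a hρ0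
  obtain ⟨j, hj⟩ := hd.exists_dist_lt b hρ0
  rw [dist_eq_norm] at hi hj
  refine ⟨i, j, ?_⟩
  have hdi : ‖d i‖ ≤ ‖a‖ + 1 := by
    have h := norm_sub_norm_le (d i) a
    rw [norm_sub_rev] at h
    linarith [min_le_left 1 (ε / L)]
  calc (K + K ^ 2) * (‖a - d i‖ * ‖b‖ + ‖d i‖ * ‖b - d j‖)
      ≤ (K + K ^ 2) * (ρ * ‖b‖ + (‖a‖ + 1) * ρ) := by gcongr
    _ ≤ L * ρ := by rw [hLd]; nlinarith
    _ ≤ L * (ε / L) := by gcongr; exact min_le_right _ _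
    _ = ε := by field_simp

theorem IsDiscreteAsymptoticHom.of_dense {A B : Type*} [NonUnitalCStarAlgebra A]
    [NonUnitalCStarAlgebra B] {d : ℕ → A} (hd : DenseRange d) {Ψ : ℕ → A → B}
    (hΨ : ∀ k, IsCompletelyPositive (Ψ k)) {M : A → ℝ} (hM : ∀ k a, ‖Ψ k a‖ ≤ M a)
    (hmul : ∀ i j, Tendsto (fun k => ‖Ψ k (d i * d j) - Ψ k (d i) * Ψ k (d j)‖) atTop (𝓝 0)) :
    IsDiscreteAsymptoticHom Ψ := by
  obtain ⟨K, hK0, hK⟩ : ∃ K : ℝ, 0 ≤ K ∧ ∀ k a, ‖Ψ k a‖ ≤ K * ‖a‖ := by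
    let T : ℕ → A →L[ℂ] B := fun k => LinearMap.mkContinuousOfExistsBound
      { toFun := Ψ k, map_add' := (hΨ k).1, map_smul' := (hΨ k).2.1 } (by
        obtain ⟨K, -, hK⟩ := (hΨ k).exists_norm_le
        exact ⟨K, hK⟩)
    obtain ⟨K, hK⟩ := banach_steinhaus (g := T) fun a => ⟨M a, fun k => hM k a⟩
    exact ⟨K, (norm_nonneg _).trans (hK 0), fun k a => (T k).le_of_opNorm_le (hK k) a⟩
  refine ⟨fun a b => ?_, fun μ₁ μ₂ a b => ?_, fun a => ?_, fun a => ⟨M a, fun k => hM k a⟩⟩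
  · refine Metric.tendsto_nhds.mpr fun ε hε => ?_
    obtain ⟨i, j, hij⟩ := exists_norm_mul_defect_sub_le hd hK0 a b (half_pos hε)
    filter_upwards [(Metric.tendsto_nhds.mp (hmul i j)) (ε / 2) (half_pos hε)] with k hk
    rw [Real.dist_eq, sub_zero, abs_norm] at hk ⊢
    have h1 := ((hΨ k).norm_mul_defect_sub_le hK0 (hK k) a b (d i) (d j)).trans hij
    have h2 := norm_sub_norm_le (Ψ k (a * b) - Ψ k a * Ψ k b)
      (Ψ k (d i * d j) - Ψ k (d i) * Ψ k (d j))
    linarith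
  · simp [(hΨ _).1, (hΨ _).2.1]
  · simp [(hΨ _).map_star]

section Homotopy

variable {A B : Type*} [NonUnitalCStarAlgebra A] [NonUnitalCStarAlgebra B]

/-- Evaluation of a homotopy of *-homomorphisms at a point of the unit interval. -/
def homotopyEval (H : A →⋆ₙₐ[ℂ] C(unitInterval, A)) (t : unitInterval) : A →⋆ₙₐ[ℂ] A where
  toFun a := H a t
  map_smul' c a := by simp
  map_zero' := by simp
  map_add' a b := by simp
  map_mul' a b := by simp
  map_star' a := by simp [map_star]

theorem eventually_homotopy_step (H : A →⋆ₙₐ[ℂ] C(unitInterval, A)) (G : Finset A) {δ : ℝ}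
    (hδ : 0 < δ) :
    ∃ N : ℕ, 0 < N ∧ ∀ s t : unitInterval, dist s t ≤ 1 / N → ∀ a ∈ G, ‖H a s - H a t‖ ≤ δ := by
  have h : ∀ a ∈ G, ∀ᶠ N : ℕ in atTop, ∀ s t : unitInterval, dist s t ≤ 1 / N →
      ‖H a s - H a t‖ ≤ δ := by
    intro a _
    obtain ⟨ρ, hρ, h⟩ := Metric.uniformContinuous_iff.mp
      (CompactSpace.uniformContinuous_of_continuous (H a).continuous) δ hδ
    filter_upwards [(tendsto_one_div_atTop_nhds_zero_nat (𝕜 := ℝ)).eventually (gt_mem_nhds hρ)]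
      with N hN s t hst
    rw [← dist_eq_norm]
    exact (h (hst.trans_lt hN)).le
  obtain ⟨N, hN0, hN⟩ := ((eventually_gt_atTop 0).and ((Filter.eventually_all_finset G).mpr h)).exists
  exact ⟨N, hN0, fun s t hst a ha => hN a ha s t hst⟩

theorem exists_cp_of_homotopy {ω : Ultrafilter ℕ} (H : A →⋆ₙₐ[ℂ] C(unitInterval, A))
    (hH0 : ∀ a, H a 0 = a) {F : A → MatProd} (hF : IsCompletelyPositive F)
    (hFJ : ∀ a b, twoOmegaMem ω (F (a * b) - F a * F b)) {K : ℝ} (hK0 : 0 ≤ K)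
    (hK : ∀ a, ‖F a‖ ≤ K * ‖a‖) {Φ : A → MatProd} (hΦ : IsCompletelyPositive Φ) {M : A → ℝ}
    (hΦM : ∀ a, ‖Φ a‖ ≤ M a) (G : Finset A) {η : ℝ} (hη : 0 < η) (hη1 : η ≤ 1)
    (hΦF : ∀ a ∈ G, ∃ j, twoOmegaMem ω j ∧ ‖Φ a - F (H a 1) - j‖ ≤ η)
    (hmul : ∀ a ∈ G, ∀ b ∈ G, ‖Φ (a * b) - Φ a * Φ b‖ ≤ η) :
    ∃ Ψ : A → MatProd, IsCompletelyPositive Ψ ∧ (∀ a, twoOmegaMem ω (Ψ a - F a)) ∧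
      (∀ a ∈ G, ∀ b ∈ G, ‖Ψ (a * b) - Ψ a * Ψ b‖ ≤ η + η) ∧ ∀ a, ‖Ψ a‖ ≤ max (M a) (K * ‖a‖) := by
  obtain ⟨N, hN0, hN⟩ := eventually_homotopy_step H G (δ := η / (K + 1)) (by positivity)
  have hN0' : (0 : ℝ) < N := by exact_mod_cast hN0
  let t : ℕ → unitInterval := fun i => Set.projIcc 0 1 zero_le_one (1 - i / N)
  have ht0 : t 0 = 1 := by simp [t]
  have htN : t N = 0 := by simp [t, div_self hN0'.ne']
  have htt : ∀ i, dist (t i) (t (i + 1)) ≤ 1 / N := fun i => by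
    rw [Subtype.dist_eq, Real.dist_eq]
    refine (Set.abs_projIcc_sub_projIcc zero_le_one).trans_eq ?_
    rw [show (1 - (i : ℝ) / N) - (1 - ((i + 1 : ℕ) : ℝ) / N) = 1 / N by push_cast; ring,
      abs_of_pos (by positivity)]
  obtain ⟨Ψ, h1, h2, h3, h4⟩ := exists_cp_matProd_glue_chain ω
    (F := fun i a => F (homotopyEval H (t i) a)) (fun i => hF.comp_starHom _) hΦ
    (fun i a b => by rw [map_mul]; exact hFJ _ _) G (δ := η) (η := η)
    (by nlinarith) (fun a ha => by
      change ∃ j, twoOmegaMem ω j ∧ ‖Φ a - F (H a (t 0)) - j‖ ≤ η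
      rw [ht0]
      exact hΦF a ha)
    (fun i a ha => by
      rw [← hF.map_sub]
      refine (hK _).trans ((mul_le_mul_of_nonneg_left (hN _ _ (htt i) a ha) hK0).trans ?_)
      rw [mul_div_assoc', div_le_iff₀ (by positivity)]
      nlinarith)
    hmul (fun a => max (M a) (K * ‖a‖)) (fun a => (hΦM a).trans (le_max_left _ _))
    (fun i a => ((hK _).trans (mul_le_mul_of_nonneg_left
      (NonUnitalStarAlgHom.norm_apply_le _ a) hK0)).trans (le_max_right _ _)) N hη
  refine ⟨Ψ, h1, fun a => ?_, h3, h4⟩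
  have h := h2 a
  change twoOmegaMem ω (Ψ a - F (H a (t N))) at h
  rwa [htN, hH0] at h

theorem AllCpLiftableHomsLiftCp.asymptotically {ω : Ultrafilter ℕ}
    (h : AllCpLiftableHomsLiftCp A ω) : AllCpLiftableHomsLiftCpAsymptotically A ω := by
  intro f hf hcp
  obtain ⟨Φ, h1, h2, h3⟩ := h f hf hcp
  refine ⟨Φ, h1, h2, fun a => ?_⟩
  have h4 : ∀ k, quotNorm ω (Φ k a - f a) = 0 := fun k => by
    refine twoOmegaMem.quotNorm_eq_zero ?_
    rw [← neg_sub]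
    exact (h3 k a).neg
  simp [h4]

theorem IsHomModJ.of_cpLift {ω : Ultrafilter ℕ} {f F : A → MatProd} (hf : IsHomModJ ω f)
    (hfF : ∀ a, twoOmegaMem ω (f a - F a)) (a b : A) :
    twoOmegaMem ω (F (a * b) - F a * F b) := by
  have h : F (a * b) - F a * F b = f (a * b) - f a * f b - (f (a * b) - F (a * b))
      + ((f a - F a) * f b + F a * (f b - F b)) := by noncomm_ring
  rw [h]
  exact ((hf.1 a b).sub (hfF _)).add (((hfF a).mul_right _).add ((hfF b).mul_left _))

theorem IsCompletelyPositive.isHomModJ {ω : Ultrafilter ℕ} {F : A → MatProd}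
    (hF : IsCompletelyPositive F) (hFJ : ∀ a b, twoOmegaMem ω (F (a * b) - F a * F b)) :
    IsHomModJ ω F := by
  refine ⟨hFJ, fun a b => ?_, fun c a => ?_, fun a => ?_⟩
  · rw [hF.1, sub_self]; exact .zero
  · rw [hF.2.1, sub_self]; exact .zero
  · rw [hF.map_star, sub_self]; exact .zero

theorem AllCpLiftableHomsLiftCpAsymptotically.of_homotopyDominated
    [TopologicalSpace.SeparableSpace A] {ω : Ultrafilter ℕ} {α : B →⋆ₙₐ[ℂ] A} {β : A →⋆ₙₐ[ℂ] B}
    (hdom : AreHomotopic (α.comp β) (NonUnitalStarAlgHom.id ℂ A))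
    (hB : AllCpLiftableHomsLiftCpAsymptotically B ω) : AllCpLiftableHomsLiftCp A ω := by
  classical
  rintro f hf ⟨F, hF, hfF⟩
  have hFJ := hf.of_cpLift hfF
  obtain ⟨K, hK0, hK⟩ := hF.exists_norm_le
  have hFα := hF.comp_starHom α
  have hFαJ : ∀ a b, twoOmegaMem ω (F (α (a * b)) - F (α a) * F (α b)) := fun a b => by
    rw [map_mul]; exact hFJ _ _
  obtain ⟨Φ, hΦ, hΦcp, hΦF⟩ := hB (fun b => F (α b)) (hFα.isHomModJ hFαJ)
    ⟨_, hFα, fun a => by rw [sub_self]; exact .zero⟩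
  obtain ⟨H, hH0, hH1⟩ := hdom
  choose M hM using hΦ.2.2.2
  have key : ∀ (G : Finset A) (η : ℝ), 0 < η → η ≤ 1 → ∃ Ψ : A → MatProd,
      IsCompletelyPositive Ψ ∧ (∀ a, twoOmegaMem ω (Ψ a - F a)) ∧
      (∀ a ∈ G, ∀ b ∈ G, ‖Ψ (a * b) - Ψ a * Ψ b‖ ≤ η + η) ∧
      ∀ a, ‖Ψ a‖ ≤ max (M (β a)) (K * ‖a‖) := by
    intro G η hη hη1
    have e1 : ∀ᶠ k in atTop, ∀ a ∈ G, ∀ b ∈ G,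
        ‖Φ k (β a * β b) - Φ k (β a) * Φ k (β b)‖ < η :=
      (Filter.eventually_all_finset G).mpr fun a _ => (Filter.eventually_all_finset G).mpr
        fun b _ => (hΦ.1 (β a) (β b)).eventually (gt_mem_nhds hη)
    have e2 : ∀ᶠ k in atTop, ∀ a ∈ G, quotNorm ω (Φ k (β a) - F (α (β a))) < η :=
      (Filter.eventually_all_finset G).mpr fun a _ =>
        (hΦF (β a)).eventually (gt_mem_nhds hη)
    obtain ⟨k, hk1, hk2⟩ := (e1.and e2).exists
    refine exists_cp_of_homotopy H hH0 hF hFJ hK0 hK ((hΦcp k).comp_starHom β)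
      (fun a => hM (β a) k) G hη hη1 (fun a ha => ?_) (fun a ha b hb => ?_)
    · obtain ⟨j, hj, h⟩ := exists_of_quotNorm_lt (hk2 a ha)
      refine ⟨-j, hj.neg, ?_⟩
      rw [sub_neg_eq_add, hH1]
      exact h.le
    · rw [map_mul]
      exact (hk1 a ha b hb).le
  let d := TopologicalSpace.denseSeq A
  choose Ψ h1 h2 h3 h4 using fun k : ℕ => key ((Finset.range k).image d) (1 / ((k : ℝ) + 1))
    (by positivity) (by rw [div_le_one (by positivity)]; linarith [k.cast_nonneg (α := ℝ)])
  refine ⟨Ψ, .of_dense (TopologicalSpace.denseRange_denseSeq A) h1 h4 fun i j => ?_, h1,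
    fun k a => ?_⟩
  · have hlim := (tendsto_one_div_add_atTop_nhds_zero_nat (𝕜 := ℝ)).add
      (tendsto_one_div_add_atTop_nhds_zero_nat (𝕜 := ℝ))
    rw [add_zero] at hlim
    refine squeeze_zero' (.of_forall fun k => norm_nonneg _) ?_ hlim
    filter_upwards [eventually_gt_atTop i, eventually_gt_atTop j] with k hi hj
    exact h3 k _ (Finset.mem_image_of_mem d (Finset.mem_range.mpr hi)) _
      (Finset.mem_image_of_mem d (Finset.mem_range.mpr hj))
  · rw [show f a - Ψ k a = (f a - F a) - (Ψ k a - F a) by abel]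
    exact (hfF a).sub (h2 k a)

end Homotopy

section Inflation

open Matrix Kronecker

/-- The *-homomorphism `T ↦ (T ⊗ 1) ⊕ 0` from `M_m` to `M_n`, with as many copies of `T` as fit. -/
def matrixInflate (m n : ℕ) :
    Matrix (Fin m) (Fin m) ℂ →⋆ₙₐ[ℂ] Matrix (Fin n) (Fin n) ℂ :=
  let e : (Fin m × Fin (n / m)) ⊕ Fin (n % m) ≃ Fin n :=
    ((finProdFinEquiv.sumCongr (Equiv.refl _)).trans finSumFinEquiv).trans
      (finCongr (Nat.div_add_mod n m))
  { toFun := fun T => Matrix.reindex e e (fromBlocks (T ⊗ₖ 1) 0 0 0)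
    map_smul' := fun c T => by
      rw [smul_kronecker]
      ext i j
      rcases h : e.symm i <;> rcases h' : e.symm j <;> simp [h, h']
    map_zero' := by simp
    map_add' := fun S T => by
      rw [add_kronecker]
      ext i j
      rcases h : e.symm i <;> rcases h' : e.symm j <;> simp [h, h']
    map_mul' := fun S T => by
      simp only [reindex_apply]
      rw [submatrix_mul_equiv, fromBlocks_multiply]
      simp [← mul_kronecker_mul]
    map_star' := fun T => by
      simp [star_eq_conjTranspose, conjTranspose_kronecker, fromBlocks_conjTranspose] }

theorem trace_matrixInflate {m n : ℕ} (T : Matrix (Fin m) (Fin m) ℂ) :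
    (matrixInflate m n T).trace = (n / m : ℕ) * T.trace := by
  change (Matrix.reindex _ _ (fromBlocks (T ⊗ₖ 1) 0 0 0)).trace = _
  refine (Equiv.sum_comp _ fun i => (fromBlocks (T ⊗ₖ 1) 0 0 0 :
    Matrix ((Fin m × Fin (n / m)) ⊕ Fin (n % m)) _ ℂ) i i).trans ?_
  change (fromBlocks (T ⊗ₖ 1) 0 0 0).trace = _
  simp [Matrix.trace, Fintype.sum_sum_type, Fintype.sum_prod_type, kroneckerMap_apply,
    Finset.mul_sum]

theorem matTrace_toEuclideanCLM {n : ℕ} (T : Matrix (Fin n) (Fin n) ℂ) :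
    matTrace n (Matrix.toEuclideanCLM (n := Fin n) (𝕜 := ℂ) T) = T.trace / n := by
  rw [matTrace_eq_sum]
  congr 1
  refine Finset.sum_congr rfl fun i _ => ?_
  simp [EuclideanSpace.inner_single_left]

/-- The inflation *-homomorphism `M_m → M_n`, with as many copies of `T` as fit. -/
def inflate (m n : ℕ) : MatAlg m →⋆ₙₐ[ℂ] MatAlg n :=
  ((Matrix.toEuclideanCLM (n := Fin n) (𝕜 := ℂ) :
      Matrix (Fin n) (Fin n) ℂ →⋆ₙₐ[ℂ] MatAlg n).comp (matrixInflate m n)).comp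
    ((Matrix.toEuclideanCLM (n := Fin m) (𝕜 := ℂ)).symm : MatAlg m →⋆ₙₐ[ℂ] _)

theorem matTrace_inflate {m n : ℕ} (T : MatAlg m) :
    matTrace n (inflate m n T) = ((m * (n / m) : ℕ) / n : ℝ) * matTrace m T := by
  obtain ⟨T, rfl⟩ : ∃ S, Matrix.toEuclideanCLM (n := Fin m) (𝕜 := ℂ) S = T :=
    ⟨(Matrix.toEuclideanCLM (n := Fin m) (𝕜 := ℂ)).symm T, by simp⟩
  have h : inflate m n (Matrix.toEuclideanCLM (n := Fin m) (𝕜 := ℂ) T) =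
      Matrix.toEuclideanCLM (n := Fin n) (𝕜 := ℂ) (matrixInflate m n T) := by
    simp [inflate]
  rw [h, matTrace_toEuclideanCLM, matTrace_toEuclideanCLM, trace_matrixInflate]
  rcases Nat.eq_zero_or_pos m with rfl | hm
  · simp
  · have : (m : ℂ) ≠ 0 := by exact_mod_cast hm.ne'
    push_cast
    field_simp

theorem norm_inflate_le {m n : ℕ} (T : MatAlg m) : ‖inflate m n T‖ ≤ ‖T‖ :=
  NonUnitalStarAlgHom.norm_apply_le (inflate m n) T

theorem re_matTrace_inflate_le {m n : ℕ} (T : MatAlg m) :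
    (matTrace n (star (inflate m n T) * inflate m n T)).re ≤ (matTrace m (star T * T)).re := by
  rw [← map_star, ← map_mul, matTrace_inflate, Complex.re_ofReal_mul]
  refine mul_le_of_le_one_left (re_matTrace_star_mul_self_nonneg T) ?_
  refine div_le_one_of_le₀ ?_ (by positivity)
  exact_mod_cast Nat.mul_div_le n m

theorem norm_matTrace_inflate_sub_le {m n : ℕ} {ε : ℝ} (hn : 0 < n) (hm : (m : ℝ) ≤ ε * n)
    (T : MatAlg m) : ‖matTrace n (inflate m n T) - matTrace m T‖ ≤ ε * ‖T‖ := by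
  have hn' : (0 : ℝ) < n := by exact_mod_cast hn
  rcases Nat.eq_zero_or_pos m with rfl | hm0
  · simp only [matTrace_inflate]
    simp [matTrace]
  have h1 : matTrace n (inflate m n T) - matTrace m T =
      (((m * (n / m) : ℕ) / n - 1 : ℝ) : ℂ) * matTrace m T := by
    rw [matTrace_inflate]; push_cast; ring
  have h2 : |((m * (n / m) : ℕ) / n - 1 : ℝ)| ≤ ε := by
    have h3 : ((m * (n / m) : ℕ) : ℝ) + (n % m : ℕ) = n := by
      exact_mod_cast Nat.div_add_mod n m
    have h4 : ((n % m : ℕ) : ℝ) ≤ m := by exact_mod_cast (Nat.mod_lt n hm0).le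
    have h5 : ((m * (n / m) : ℕ) / n - 1 : ℝ) = -((n % m : ℕ) / n) := by
      field_simp
      linarith
    rw [h5, abs_neg, abs_of_nonneg (by positivity), div_le_iff₀ hn']
    linarith
  rw [h1, norm_mul, Complex.norm_real, Real.norm_eq_abs]
  exact mul_le_mul h2 (norm_matTrace_le T) (norm_nonneg _) ((abs_nonneg _).trans h2)

end Inflation

theorem norm_sq_entry_le {D : Type*} [NonUnitalCStarAlgebra D] {k : ℕ}
    (z : Matrix (Fin k) (Fin k) D) (i j : Fin k) : ‖z i j‖ ^ 2 ≤ ‖(star z * z) j j‖ := by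
  let _ : PartialOrder D := CStarAlgebra.spectralOrder D
  have : StarOrderedRing D := CStarAlgebra.spectralOrderedRing D
  rw [sq, ← CStarRing.norm_star_mul_self]
  refine CStarAlgebra.norm_le_norm_of_nonneg_of_le (star_mul_self_nonneg _) ?_
  rw [Matrix.mul_apply]
  exact Finset.single_le_sum (f := fun i => star (z i j) * z i j)
    (fun i _ => star_mul_self_nonneg _) (Finset.mem_univ i)

theorem memℓp_of_ccp {A : Type*} [NonUnitalCStarAlgebra A] {ψ : ∀ n, A → MatAlg n}
    (hψ : ∀ n, IsCCP (ψ n)) (a : A) : Memℓp (fun n => ψ n a) ∞ :=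
  memℓp_infty ⟨‖a‖, by
    rintro _ ⟨n, rfl⟩
    exact (hψ n).2 a⟩

/-- The ccp map into `∏ₙ M_n` with given ccp coordinates. -/
def ccpProd {A : Type*} [NonUnitalCStarAlgebra A] {ψ : ∀ n, A → MatAlg n}
    (hψ : ∀ n, IsCCP (ψ n)) (a : A) : MatProd :=
  ⟨fun n => ψ n a, memℓp_of_ccp hψ a⟩

theorem isCCP_ccpProd {A : Type*} [NonUnitalCStarAlgebra A] {ψ : ∀ n, A → MatAlg n}
    (hψ : ∀ n, IsCCP (ψ n)) : IsCCP (ccpProd hψ) := by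
  refine ⟨⟨fun a b => ?_, fun c a => ?_, fun k x hx => ?_⟩, fun a => ?_⟩
  · ext n : 2
    exact (hψ n).1.1 a b
  · ext n : 2
    exact (hψ n).1.2.1 c a
  · choose z hz using fun n => (hψ n).1.2.2 k x hx
    have hmem : ∀ i j, Memℓp (fun n => z n i j) ∞ := fun i j => by
      refine memℓp_infty ⟨√‖x j j‖, ?_⟩
      rintro _ ⟨n, rfl⟩
      refine Real.le_sqrt_of_sq_le ((norm_sq_entry_le (z n) i j).trans ?_)
      rw [← hz n]
      exact (hψ n).2 _
    let Z : Matrix (Fin k) (Fin k) MatProd := fun i j => ⟨fun n => z n i j, hmem i j⟩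
    refine ⟨Z, ?_⟩
    refine Matrix.ext fun i j => lp.ext (E := fun n => MatAlg n) (p := ∞) (funext fun n => ?_)
    have h := congrFun (congrFun (hz n) i) j
    rw [Matrix.mul_apply] at h
    have h' : ((star Z * Z) i j : MatProd) = ∑ l, star (Z l i) * Z l j := Matrix.mul_apply
    refine h.trans ((congrArg (fun y : MatProd => y n) h').trans ?_).symm
    refine (congrFun (lp.coeFn_sum (E := fun n => MatAlg n) (p := ∞)
      (fun l => star (Z l i) * Z l j) Finset.univ) n).trans ?_
    rw [Finset.sum_apply]
    rfl
  · refine lp.norm_le_of_forall_le (norm_nonneg a) fun n => ?_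
    exact (hψ n).2 a

theorem exists_tendsto_atTop_mul_le (m : ℕ → ℕ) :
    ∃ k : ℕ → ℕ, Tendsto k atTop atTop ∧ ∀ᶠ n in atTop, m (k n) * (k n + 1) ≤ n := by
  let P : ℕ → ℕ → Prop := fun n k => m k * (k + 1) ≤ n
  refine ⟨fun n => Nat.findGreatest (P n) n, tendsto_atTop.2 fun j => ?_, ?_⟩
  · filter_upwards [eventually_ge_atTop j, eventually_ge_atTop (m j * (j + 1))] with n h1 h2
    exact Nat.le_findGreatest h1 h2
  · filter_upwards [eventually_ge_atTop (m 0 * (0 + 1))] with n h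
    exact Nat.findGreatest_spec (P := P n) (Nat.zero_le n) h

theorem exists_hom_of_isAmenableTrace {C : Type*} [NonUnitalCStarAlgebra C]
    [TopologicalSpace.SeparableSpace C] {ω : Ultrafilter ℕ}
    (hω : (ω : Filter ℕ) ≤ Filter.cofinite) {τ : C → ℂ} (hτ : IsTrace τ)
    (hτa : IsAmenableTrace τ) :
    ∃ f : C → MatProd, IsCCP f ∧ (∀ a b, twoOmegaMem ω (f (a * b) - f a * f b)) ∧
      ∀ a, Tendsto (fun n => matTrace n (f a n)) (ω : Filter ℕ) (𝓝 (τ a)) := by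
  classical
  let d : ℕ → C := TopologicalSpace.denseSeq C
  have hd : DenseRange d := TopologicalSpace.denseRange_denseSeq C
  choose m φ hφ hmul htr using fun k : ℕ =>
    hτa ((Finset.range k).image d) (1 / (k + 1 : ℝ)) (by positivity)
  obtain ⟨k, hk, hkm⟩ := exists_tendsto_atTop_mul_le m
  have hωtop : (ω : Filter ℕ) ≤ atTop := hω.trans_eq Nat.cofinite_eq_atTop
  have hd_mem : ∀ {i n}, i < k n → d i ∈ (Finset.range (k n)).image d := fun h =>
    Finset.mem_image_of_mem d (Finset.mem_range.2 h)
  have hψ : ∀ n, IsCCP fun a => inflate (m (k n)) n (φ (k n) a) := fun n =>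
    ⟨(hφ (k n)).1.starHom_comp _, fun a => (norm_inflate_le _).trans ((hφ (k n)).2 a)⟩
  have hlim : Tendsto (fun n => 1 / ((k n : ℝ) + 1)) (ω : Filter ℕ) (𝓝 0) :=
    (tendsto_one_div_add_atTop_nhds_zero_nat.comp hk).mono_left hωtop
  have hf := isCCP_ccpProd hψ
  have hfd : ∀ i j, twoOmegaMem ω
      (ccpProd hψ (d i * d j) - ccpProd hψ (d i) * ccpProd hψ (d j)) := by
    intro i j
    have hlim2 : Tendsto (fun n => (1 / ((k n : ℝ) + 1)) ^ 2) (ω : Filter ℕ) (𝓝 0) := by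
      simpa using hlim.pow 2
    refine squeeze_zero' (.of_forall fun n => re_matTrace_star_mul_self_nonneg _) ?_ hlim2
    filter_upwards [hωtop (hk.eventually_gt_atTop i), hωtop (hk.eventually_gt_atTop j)]
      with n hi hj
    have h := hmul (k n) _ (hd_mem hi) _ (hd_mem hj)
    rw [l2Norm, Real.sqrt_lt' (by positivity)] at h
    refine le_trans ?_ h.le
    have h2 := re_matTrace_inflate_le (n := n)
      (φ (k n) (d i * d j) - φ (k n) (d i) * φ (k n) (d j))
    rw [_root_.map_sub, map_mul] at h2
    exact h2
  refine ⟨ccpProd hψ, hf, fun a b => ?_, fun a => ?_⟩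
  · refine twoOmegaMem.of_forall_approx fun ε hε => ?_
    obtain ⟨i, j, hij⟩ := exists_norm_mul_defect_sub_le hd zero_le_one a b hε
    exact ⟨_, hfd i j, (hf.1.norm_mul_defect_sub_le zero_le_one
      (fun a => (hf.2 a).trans_eq (one_mul _).symm) a b (d i) (d j)).trans hij⟩
  · refine Metric.tendsto_nhds.mpr fun ε hε => ?_
    obtain ⟨i, hi⟩ := hd.exists_dist_lt a (show 0 < ε / 4 by positivity)
    rw [dist_eq_norm] at hi
    have hlim3 : Tendsto (fun n => 1 / ((k n : ℝ) + 1) * (‖d i‖ + 1)) (ω : Filter ℕ) (𝓝 0) := by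
      simpa using hlim.mul_const (‖d i‖ + 1)
    filter_upwards [hωtop (hk.eventually_gt_atTop i), hωtop hkm, hωtop (eventually_gt_atTop 0),
      hlim3.eventually_lt_const (show (0 : ℝ) < ε / 2 by positivity)] with n hin hn hn0 hlt
    have h1 : ‖matTrace n (ccpProd hψ a n) - matTrace n (ccpProd hψ (d i) n)‖ ≤ ‖a - d i‖ := by
      rw [← matTrace_sub]
      refine (norm_matTrace_le _).trans ?_
      have := (hψ n).1.map_sub a (d i)
      exact (congrArg norm this).symm.le.trans ((hψ n).2 _)
    have h2 : ‖matTrace n (ccpProd hψ (d i) n) - matTrace (m (k n)) (φ (k n) (d i))‖ ≤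
        1 / ((k n : ℝ) + 1) * ‖d i‖ := by
      refine (norm_matTrace_inflate_sub_le hn0 (ε := 1 / ((k n : ℝ) + 1)) ?_ _).trans ?_
      · rw [div_mul_eq_mul_div, one_mul, le_div_iff₀ (by positivity)]
        exact_mod_cast hn
      · gcongr
        exact (hφ (k n)).2 _
    have h3 := htr (k n) _ (hd_mem hin)
    have h4 : ‖τ a - τ (d i)‖ ≤ ‖a - d i‖ := by
      have h5 : τ (a - d i) = τ a - τ (d i) := by
        rw [sub_eq_add_neg, hτ.1, ← neg_one_smul ℂ (d i), hτ.2.1]; ring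
      rw [← h5]
      exact hτ.2.2.2.2 _
    rw [dist_eq_norm]
    calc ‖matTrace n (ccpProd hψ a n) - τ a‖
        = ‖(matTrace n (ccpProd hψ a n) - matTrace n (ccpProd hψ (d i) n)) +
          (matTrace n (ccpProd hψ (d i) n) - matTrace (m (k n)) (φ (k n) (d i))) -
          (τ (d i) - matTrace (m (k n)) (φ (k n) (d i))) - (τ a - τ (d i))‖ := by
            congr 1; ring
      _ ≤ ‖a - d i‖ + 1 / ((k n : ℝ) + 1) * ‖d i‖ + 1 / ((k n : ℝ) + 1) + ‖a - d i‖ :=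
        (norm_sub_le _ _).trans (add_le_add ((norm_sub_le _ _).trans
          (add_le_add ((norm_add_le _ _).trans (add_le_add h1 h2)) h3.le)) h4)
      _ < ε := by linarith

theorem exists_selfAdjoint_compression {C : Type*} [NonUnitalCStarAlgebra C] (G : Finset C)
    {ε : ℝ} (hε : 0 < ε) :
    ∃ d : C, star d = d ∧ ‖d‖ ≤ 1 ∧ (∀ a ∈ G, ‖d * a * d - a‖ ≤ ε) ∧
      ∀ a ∈ G, ∀ b ∈ G, ‖a * b - a * (d * d) * b‖ ≤ ε := by
  let _ : PartialOrder C := CStarAlgebra.spectralOrder C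
  have : StarOrderedRing C := CStarAlgebra.spectralOrderedRing C
  have h := CStarAlgebra.increasingApproximateUnit C
  have := h.neBot
  have h1 : ∀ a : C, Tendsto (fun d => d * a * d) (CStarAlgebra.approximateUnit C) (𝓝 a) := by
    intro a
    refine tendsto_iff_norm_sub_tendsto_zero.2 ?_
    have hl := tendsto_iff_norm_sub_tendsto_zero.1 (h.tendsto_mul_right a)
    have hr := tendsto_iff_norm_sub_tendsto_zero.1 (h.tendsto_mul_left a)
    refine squeeze_zero' (.of_forall fun d => norm_nonneg _) ?_ (by simpa using hl.add hr)
    filter_upwards [h.eventually_norm] with d hd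
    calc ‖d * a * d - a‖ = ‖(d * a - a) * d + (a * d - a)‖ := by congr 1; noncomm_ring
      _ ≤ ‖d * a - a‖ * ‖d‖ + ‖a * d - a‖ :=
        (norm_add_le _ _).trans (add_le_add_left (norm_mul_le _ _) _)
      _ ≤ ‖d * a - a‖ + ‖a * d - a‖ := by
        gcongr
        exact mul_le_of_le_one_right (norm_nonneg _) hd
  have h2 : ∀ a b : C, Tendsto (fun d => a * (d * d) * b) (CStarAlgebra.approximateUnit C)
      (𝓝 (a * b)) := by
    intro a b
    have := (h.tendsto_mul_left a).mul (h.tendsto_mul_right b)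
    refine this.congr fun d => ?_
    noncomm_ring
  have h3 : ∀ᶠ d in CStarAlgebra.approximateUnit C, ∀ a ∈ G, ‖d * a * d - a‖ ≤ ε :=
    (Filter.eventually_all_finset G).2 fun a _ =>
      ((tendsto_iff_norm_sub_tendsto_zero.1 (h1 a)).eventually_le_const hε)
  have h4 : ∀ᶠ d in CStarAlgebra.approximateUnit C, ∀ a ∈ G, ∀ b ∈ G,
      ‖a * b - a * (d * d) * b‖ ≤ ε :=
    (Filter.eventually_all_finset G).2 fun a _ => (Filter.eventually_all_finset G).2 fun b _ => by
      filter_upwards [(tendsto_iff_norm_sub_tendsto_zero.1 (h2 a b)).eventually_le_const hε]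
        with d hd
      rwa [norm_sub_rev]
  obtain ⟨d, hs, hn, h3, h4⟩ := (h.eventually_star_eq.and (h.eventually_norm.and (h3.and h4))).exists
  exact ⟨d, hs, hn, h3, h4⟩

section Compression

variable {C D : Type*} [NonUnitalCStarAlgebra C] [NonUnitalCStarAlgebra D] {Φ : C → D} {d : C}
  {e : ℝ}

theorem IsCompletelyPositive.norm_map_sq_le_one_add (hΦ : IsCompletelyPositive Φ) (hd : star d = d)
    (hd1 : ‖d‖ ≤ 1) (he : 0 ≤ e) (h : ‖Φ (d * d * (d * d)) - Φ (d * d) * Φ (d * d)‖ ≤ e) :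
    ‖Φ (d * d)‖ ≤ 1 + e := by
  have h1 : ‖Φ (d * d) * Φ (d * d)‖ = ‖Φ (d * d)‖ * ‖Φ (d * d)‖ := by
    have hs : star (Φ (d * d)) = Φ (d * d) := by rw [← hΦ.map_star, star_mul, hd]
    rw [← CStarRing.norm_star_mul_self, hs]
  have h2 : ‖Φ (d * d * (d * d))‖ ≤ ‖Φ (d * d)‖ := by
    have h3 := hΦ.norm_conj_le hd (d * d)
    have h4 : ‖d * d‖ ≤ 1 := (norm_mul_le _ _).trans (mul_le_one₀ hd1 (norm_nonneg _) hd1)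
    rw [show d * d * (d * d) = d * (d * d) * d by noncomm_ring]
    exact h3.trans (mul_le_of_le_one_left (norm_nonneg _) h4)
  have h5 := norm_sub_norm_le (Φ (d * d) * Φ (d * d)) (Φ (d * d * (d * d)))
  rw [norm_sub_rev, h1] at h5
  nlinarith [norm_nonneg (Φ (d * d))]

theorem IsCompletelyPositive.norm_conj_le_one_add (hΦ : IsCompletelyPositive Φ) (hd : star d = d)
    (hΦd : ‖Φ (d * d)‖ ≤ 1 + e) (a : C) : ‖Φ (d * a * d)‖ ≤ (1 + e) * ‖a‖ :=
  (hΦ.norm_conj_le hd a).trans (by rw [mul_comm]; gcongr)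

theorem IsCompletelyPositive.isCCP_conj (hΦ : IsCompletelyPositive Φ) (hd : star d = d)
    (he : 0 ≤ e) (hΦd : ‖Φ (d * d)‖ ≤ 1 + e) :
    IsCCP fun a => (((1 + e)⁻¹ : ℝ) : ℂ) • Φ (d * a * d) := by
  have h := (hΦ.comp_conj d).smul (inv_nonneg.2 (show 0 ≤ 1 + e by positivity))
  rw [hd] at h
  refine ⟨h, fun a => ?_⟩
  rw [norm_smul, Complex.norm_real, Real.norm_of_nonneg (by positivity),
    inv_mul_le_iff₀ (by positivity)]
  exact hΦ.norm_conj_le_one_add hd hΦd a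

theorem IsCompletelyPositive.norm_inv_smul_conj_sub_le (hΦ : IsCompletelyPositive Φ)
    (hd : star d = d) (he : 0 ≤ e) (hΦd : ‖Φ (d * d)‖ ≤ 1 + e) (a : C) :
    ‖(((1 + e)⁻¹ : ℝ) : ℂ) • Φ (d * a * d) - Φ (d * a * d)‖ ≤ e * ‖a‖ := by
  have h1 : (((1 + e)⁻¹ : ℝ) : ℂ) • Φ (d * a * d) - Φ (d * a * d) =
      (((1 + e)⁻¹ - 1 : ℝ) : ℂ) • Φ (d * a * d) := by
    push_cast
    rw [sub_smul, one_smul]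
  have h2 : (1 + e)⁻¹ - 1 = -(e / (1 + e)) := by field_simp; ring
  rw [h1, norm_smul, Complex.norm_real, h2, norm_neg, Real.norm_of_nonneg (by positivity)]
  calc e / (1 + e) * ‖Φ (d * a * d)‖ ≤ e / (1 + e) * ((1 + e) * ‖a‖) := by
        gcongr
        exact hΦ.norm_conj_le_one_add hd hΦd a
    _ = e * ‖a‖ := by field_simp

theorem IsCompletelyPositive.norm_conj_mul_sub_le (hΦ : IsCompletelyPositive Φ)
    (hd : star d = d) (he : 0 ≤ e) (hΦd : ‖Φ (d * d)‖ ≤ 1 + e) {a b : C}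
    (hab : ‖a * b - a * (d * d) * b‖ ≤ e)
    (h : ‖Φ (d * a * d * (d * b * d)) - Φ (d * a * d) * Φ (d * b * d)‖ ≤ e) :
    ‖(((1 + e)⁻¹ : ℝ) : ℂ) • Φ (d * (a * b) * d) -
      ((((1 + e)⁻¹ : ℝ) : ℂ) • Φ (d * a * d)) * ((((1 + e)⁻¹ : ℝ) : ℂ) • Φ (d * b * d))‖ ≤
      (1 + e) * e + e + e * (‖a‖ * ‖b‖) := by
  set s : ℝ := (1 + e)⁻¹ with hs
  have hs0 : 0 ≤ s := by positivity
  have hs1 : s ≤ 1 := inv_le_one_of_one_le₀ (by linarith)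
  have h1 : ‖Φ (d * (a * b) * d) - Φ (d * a * d) * Φ (d * b * d)‖ ≤ (1 + e) * e + e := by
    have h2 : Φ (d * (a * b) * d) - Φ (d * a * d) * Φ (d * b * d) =
        Φ (d * (a * b - a * (d * d) * b) * d) +
          (Φ (d * a * d * (d * b * d)) - Φ (d * a * d) * Φ (d * b * d)) := by
      have h3 : d * (a * b) * d = d * (a * b - a * (d * d) * b) * d + d * a * d * (d * b * d) := by
        noncomm_ring
      rw [h3, hΦ.1]
      abel
    rw [h2]
    refine (norm_add_le _ _).trans (add_le_add ?_ h)
    refine (hΦ.norm_conj_le_one_add hd hΦd _).trans ?_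
    gcongr
  have h4 : (s : ℂ) • Φ (d * (a * b) * d) - ((s : ℂ) • Φ (d * a * d)) * ((s : ℂ) • Φ (d * b * d)) =
      ((s : ℂ) * s) • (Φ (d * (a * b) * d) - Φ (d * a * d) * Φ (d * b * d)) -
        (s : ℂ) • ((s : ℂ) • Φ (d * (a * b) * d) - Φ (d * (a * b) * d)) := by
    rw [smul_mul_smul_comm, smul_sub, smul_sub, smul_smul]
    abel
  rw [h4]
  refine (norm_sub_le _ _).trans (add_le_add ?_ ?_)
  · rw [norm_smul, norm_mul, Complex.norm_real, Real.norm_of_nonneg hs0]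
    exact (mul_le_of_le_one_left (norm_nonneg _) (mul_le_one₀ hs1 hs0 hs1)).trans h1
  · rw [norm_smul, Complex.norm_real, Real.norm_of_nonneg hs0]
    refine (mul_le_of_le_one_left (norm_nonneg _) hs1).trans ?_
    refine (hΦ.norm_inv_smul_conj_sub_le hd he hΦd _).trans ?_
    gcongr
    exact norm_mul_le _ _

end Compression

theorem twoOmegaMem.tendsto_matTrace {ω : Ultrafilter ℕ} {x : MatProd} (hx : twoOmegaMem ω x) :
    Tendsto (fun n => matTrace n (x n)) (ω : Filter ℕ) (𝓝 0) := by
  refine tendsto_zero_iff_norm_tendsto_zero.2 ?_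
  have h := hx.sqrt
  rw [Real.sqrt_zero] at h
  exact squeeze_zero (fun n => norm_nonneg _)
    (fun n => Real.le_sqrt_of_sq_le (norm_matTrace_sq_le _)) h

/-- The coordinate *-homomorphism `∏ₙ M_n → M_n`. -/
def matProdEval (n : ℕ) : MatProd →⋆ₙₐ[ℂ] MatAlg n where
  toFun x := x n
  map_smul' _ _ := rfl
  map_zero' := rfl
  map_add' _ _ := rfl
  map_mul' _ _ := rfl
  map_star' _ := rfl

theorem AllCpLiftableHomsLiftCpAsymptotically.isQuasidiagonalTrace {C : Type*}
    [NonUnitalCStarAlgebra C] [TopologicalSpace.SeparableSpace C] {ω : Ultrafilter ℕ}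
    (hω : (ω : Filter ℕ) ≤ Filter.cofinite) (hC : AllCpLiftableHomsLiftCpAsymptotically C ω)
    {τ : C → ℂ} (hτ : IsTrace τ) (hτa : IsAmenableTrace τ) : IsQuasidiagonalTrace τ := by
  intro G ε hε
  obtain ⟨f, hf, hfmul, hfτ⟩ := exists_hom_of_isAmenableTrace hω hτ hτa
  obtain ⟨Φ, hΦ, hΦcp, hΦf⟩ := hC f (hf.1.isHomModJ hfmul)
    ⟨f, hf.1, fun a => by rw [sub_self]; exact .zero⟩
  set M : ℝ := 1 + ∑ a ∈ G, ‖a‖ with hM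
  have hM1 : 1 ≤ M := le_add_of_nonneg_right (Finset.sum_nonneg fun a _ => norm_nonneg a)
  have hGM : ∀ a ∈ G, ‖a‖ ≤ M := fun a ha =>
    (Finset.single_le_sum (fun a _ => norm_nonneg a) ha).trans (le_add_of_nonneg_left zero_le_one)
  set e : ℝ := min 1 (ε / (5 + M ^ 2)) with he_def
  have he : 0 < e := lt_min one_pos (by positivity)
  have he1 : e ≤ 1 := min_le_left _ _
  have heε : e * (5 + M ^ 2) ≤ ε := (le_div_iff₀ (by positivity)).1 (min_le_right _ _)
  obtain ⟨d, hd, hd1, hdG, hdGG⟩ := exists_selfAdjoint_compression G he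
  obtain ⟨k, hk0, hkm, hkq⟩ :
      ∃ k, ‖Φ k (d * d * (d * d)) - Φ k (d * d) * Φ k (d * d)‖ ≤ e ∧
        (∀ a ∈ G, ∀ b ∈ G, ‖Φ k (d * a * d * (d * b * d)) -
          Φ k (d * a * d) * Φ k (d * b * d)‖ ≤ e) ∧
        ∀ a ∈ G, quotNorm ω (Φ k (d * a * d) - f (d * a * d)) < e := by
    have h1 : ∀ᶠ k in atTop, ∀ a ∈ G, ∀ b ∈ G, ‖Φ k (d * a * d * (d * b * d)) -
        Φ k (d * a * d) * Φ k (d * b * d)‖ ≤ e :=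
      (Filter.eventually_all_finset G).2 fun a _ => (Filter.eventually_all_finset G).2 fun b _ =>
        (hΦ.1 _ _).eventually_le_const he
    have h2 : ∀ᶠ k in atTop, ∀ a ∈ G, quotNorm ω (Φ k (d * a * d) - f (d * a * d)) < e :=
      (Filter.eventually_all_finset G).2 fun a _ => (hΦf _).eventually_lt_const he
    exact (((hΦ.1 _ _).eventually_le_const he).and (h1.and h2)).exists
  have hΦd := (hΦcp k).norm_map_sq_le_one_add hd hd1 he.le hk0
  have hccp := (hΦcp k).isCCP_conj hd he.le hΦd
  have htr : ∀ᶠ n in (ω : Filter ℕ), ∀ a ∈ G,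
      ‖τ (d * a * d) - matTrace n (Φ k (d * a * d) n)‖ < 3 * e := by
    refine (Filter.eventually_all_finset G).2 fun a ha => ?_
    obtain ⟨j, hj, hjn⟩ := exists_of_quotNorm_lt (hkq a ha)
    filter_upwards [Metric.tendsto_nhds.mp (hfτ (d * a * d)) e he,
      Metric.tendsto_nhds.mp hj.tendsto_matTrace e he] with n h1 h2
    rw [dist_eq_norm] at h1
    rw [dist_zero_right] at h2
    have h3 : ‖matTrace n (Φ k (d * a * d) n) - matTrace n (f (d * a * d) n) +
        matTrace n (j n)‖ < e := by
      rw [← matTrace_sub, ← matTrace_add]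
      exact (norm_matTrace_le _).trans_lt
        ((lp.norm_apply_le_norm ENNReal.top_ne_zero _ n).trans_lt hjn)
    rw [norm_sub_rev]
    calc ‖matTrace n (Φ k (d * a * d) n) - τ (d * a * d)‖
        = ‖(matTrace n (Φ k (d * a * d) n) - matTrace n (f (d * a * d) n) + matTrace n (j n)) +
          (matTrace n (f (d * a * d) n) - τ (d * a * d)) - matTrace n (j n)‖ := by
            congr 1; ring
      _ < e + e + e := (norm_sub_le _ _).trans_lt
        (add_lt_add ((norm_add_le _ _).trans_lt (add_lt_add h3 h1)) h2)
      _ = 3 * e := by ring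
  obtain ⟨n, hn⟩ := htr.exists
  refine ⟨n, fun a => matProdEval n ((((1 + e)⁻¹ : ℝ) : ℂ) • Φ k (d * a * d)),
    ⟨hccp.1.starHom_comp _, fun a =>
      (lp.norm_apply_le_norm ENNReal.top_ne_zero _ n).trans (hccp.2 a)⟩, ?_, ?_⟩
  · intro a ha b hb
    have h1 := (hΦcp k).norm_conj_mul_sub_le hd he.le hΦd (hdGG a ha b hb) (hkm a ha b hb)
    refine ((lp.norm_apply_le_norm ENNReal.top_ne_zero _ n).trans h1).trans_lt ?_
    have h2 : ‖a‖ * ‖b‖ ≤ M ^ 2 := by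
      rw [sq]
      exact mul_le_mul (hGM a ha) (hGM b hb) (norm_nonneg _) (by positivity)
    nlinarith
  · intro a ha
    have h1 := hn a ha
    have h2 : ‖τ a - τ (d * a * d)‖ ≤ e := by
      have h5 : τ (a - d * a * d) = τ a - τ (d * a * d) := by
        rw [sub_eq_add_neg, hτ.1, ← neg_one_smul ℂ (d * a * d), hτ.2.1]; ring
      rw [← h5]
      exact (hτ.2.2.2.2 _).trans ((norm_sub_rev _ _).trans_le (hdG a ha))
    have h3 : ‖matTrace n (((((1 + e)⁻¹ : ℝ) : ℂ) • Φ k (d * a * d)) n) -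
        matTrace n (Φ k (d * a * d) n)‖ ≤ e * ‖a‖ := by
      rw [← matTrace_sub]
      exact (norm_matTrace_le _).trans ((lp.norm_apply_le_norm ENNReal.top_ne_zero _ n).trans
        ((hΦcp k).norm_inv_smul_conj_sub_le hd he.le hΦd a))
    change ‖τ a - matTrace n (((((1 + e)⁻¹ : ℝ) : ℂ) • Φ k (d * a * d)) n)‖ < ε
    calc ‖τ a - matTrace n (((((1 + e)⁻¹ : ℝ) : ℂ) • Φ k (d * a * d)) n)‖
        = ‖(τ a - τ (d * a * d)) + (τ (d * a * d) - matTrace n (Φ k (d * a * d) n)) -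
          (matTrace n (((((1 + e)⁻¹ : ℝ) : ℂ) • Φ k (d * a * d)) n) -
            matTrace n (Φ k (d * a * d) n))‖ := by congr 1; ring
      _ ≤ e + 3 * e + e * ‖a‖ := (norm_sub_le _ _).trans
        (add_le_add ((norm_add_le _ _).trans (add_le_add h2 h1.le)) h3)
      _ < ε := by
        have h4 : ‖a‖ ≤ M ^ 2 := (hGM a ha).trans (le_self_pow₀ hM1 two_ne_zero)
        nlinarith

/-- Suppose every ∗-homomorphism from a separable C*-algebra `B` to `∏ₙ M_n / ⊕_{2,ω} M_n`
that has a cp lift to `∏ₙ M_n` lifts (resp. asymptotically lifts) to a cp discrete asymptotic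
homomorphism into `∏ₙ M_n`.  Then (1) every amenable trace on `B` is quasidiagonal; (2) if a
separable C*-algebra `A` is homotopy dominated by `B`, then every ∗-homomorphism from `A` to
`∏ₙ M_n / ⊕_{2,ω} M_n` that has a cp lift lifts (resp. asymptotically lifts) to a cp discrete
asymptotic homomorphism into `∏ₙ M_n`; in particular every amenable trace on `A` is
quasidiagonal. -/
theorem cp_homs_lift_traces_quasidiagonal
    {B A : Type*} [NonUnitalCStarAlgebra B] [NonUnitalCStarAlgebra A]
    [TopologicalSpace.SeparableSpace B] [TopologicalSpace.SeparableSpace A]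
    (ω : Ultrafilter ℕ) (hω : (ω : Filter ℕ) ≤ Filter.cofinite)
    (α : B →⋆ₙₐ[ℂ] A) (β : A →⋆ₙₐ[ℂ] B)
    (hdom : AreHomotopic (α.comp β) (NonUnitalStarAlgHom.id ℂ A)) :
    -- version with genuine lifts
    (AllCpLiftableHomsLiftCp B ω →
      (∀ τ : B → ℂ, IsTrace τ → IsAmenableTrace τ → IsQuasidiagonalTrace τ) ∧
      AllCpLiftableHomsLiftCp A ω ∧
      (∀ τ : A → ℂ, IsTrace τ → IsAmenableTrace τ → IsQuasidiagonalTrace τ)) ∧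
    -- version with asymptotic lifts
    (AllCpLiftableHomsLiftCpAsymptotically B ω →
      (∀ τ : B → ℂ, IsTrace τ → IsAmenableTrace τ → IsQuasidiagonalTrace τ) ∧
      AllCpLiftableHomsLiftCpAsymptotically A ω ∧
      (∀ τ : A → ℂ, IsTrace τ → IsAmenableTrace τ → IsQuasidiagonalTrace τ)) := by
  have hA := fun h : AllCpLiftableHomsLiftCpAsymptotically B ω => h.of_homotopyDominated hdom
  refine ⟨fun h => ⟨fun τ => h.asymptotically.isQuasidiagonalTrace hω, hA h.asymptotically,
    fun τ => (hA h.asymptotically).asymptotically.isQuasidiagonalTrace hω⟩, fun h =>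
    ⟨fun τ => h.isQuasidiagonalTrace hω, (hA h).asymptotically,
      fun τ => (hA h).asymptotically.isQuasidiagonalTrace hω⟩⟩

end
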